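/- arXiv:1903.00236 — 2 statements merged into one kernel-verified Lean document; each statement's English description precedes it below -/
import Mathlib

section
/- Assume: (1) ζ is locally Lipschitz continuous, θ is continuous and differentiable in x and u, f is continuous and differentiable in x, and ∇_x θ, ∇_u θ and ∇_x f are continuous; (2) either q = +∞, or θ and ∇_x θ satisfy the growth condition of order (q,1), ∇_u θ satisfies the growth condition of order (q−1, q') (q' the conjugate exponent of q), and f and ∇_x f satisfy the growth condition of order (q/p, p); (3) there exists a globally optimal solution of the free-endpoint optimal control problem; (4) there exist λ₀ > 0, c > I*, and δ > 0 such that the set S_{λ₀}(c) ∩ Ω_δ is bounded in W^{1,p}_d(0,T) × L^q_m(0,T) and Φ_{λ₀} is bounded below on A. Then there exists λ* ≥ 0 such that for any λ ≥ λ* the penalty function Φ_λ is completely exact on S_λ(c). -/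
open MeasureTheory Set Filter Topology
open scoped ENNReal NNReal

noncomputable section

/-- `ℝ^n` as a Euclidean space. -/
abbrev Vec (n : ℕ) := EuclideanSpace ℝ (Fin n)

/-- Lebesgue measure restricted to the interval `(0, T]`. -/
noncomputable def muT (T : ℝ) : Measure ℝ := volume.restrict (Set.Ioc 0 T)

/-- Membership in `W^{1,p}_d(0,T)`: `x` is absolutely continuous on `[0,T]` with derivative
`x' ∈ L^p(0,T)`. -/
def InW {d : ℕ} (T p : ℝ) (x x' : ℝ → Vec d) : Prop :=
  IntervalIntegrable x' volume 0 T ∧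
  (∀ t ∈ Set.Icc 0 T, x t = x 0 + ∫ s in (0:ℝ)..t, x' s) ∧
  MemLp x' (ENNReal.ofReal p) (muT T)

/-- The objective functional `I(x,u) = ∫₀^T θ(x(t),u(t),t) dt + ζ(x(T))`. -/
noncomputable def objFun {d m : ℕ} (T : ℝ) (θ : Vec d → Vec m → ℝ → ℝ) (ζ : Vec d → ℝ)
    (x : ℝ → Vec d) (u : ℝ → Vec m) : ℝ :=
  (∫ t in Set.Ioc (0:ℝ) T, θ (x t) (u t) t) + ζ (x T)

/-- The penalty term `φ(x,u) = ‖ẋ − f(x(·),u(·),·)‖_p` (with values in `[0,+∞]`). -/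
noncomputable def penTerm {d m : ℕ} (T p : ℝ) (f : Vec d → Vec m → ℝ → Vec d)
    (x x' : ℝ → Vec d) (u : ℝ → Vec m) : ℝ≥0∞ :=
  eLpNorm (fun t => x' t - f (x t) (u t) t) (ENNReal.ofReal p) (muT T)

/-- The penalty function `Φ_λ(x,u) = I(x,u) + λ φ(x,u)` (with values in `ℝ ∪ {±∞}`). -/
noncomputable def penFun {d m : ℕ} (T p : ℝ) (θ : Vec d → Vec m → ℝ → ℝ)
    (f : Vec d → Vec m → ℝ → Vec d) (ζ : Vec d → ℝ) (lam : ℝ)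
    (x x' : ℝ → Vec d) (u : ℝ → Vec m) : EReal :=
  ((objFun T θ ζ x u : ℝ) : EReal) + (lam : EReal) * ((penTerm T p f x x' u : ℝ≥0∞) : EReal)

/-- Membership in the set `A`: `(x,u) ∈ W^{1,p}_d × L^q_m` with `x(0) = x₀` and `u ∈ U`. -/
def memA {d m : ℕ} (T p : ℝ) (q : ℝ≥0∞) (U : Set (ℝ → Vec m)) (x₀ : Vec d)
    (x x' : ℝ → Vec d) (u : ℝ → Vec m) : Prop :=
  InW T p x x' ∧ MemLp u q (muT T) ∧ u ∈ U ∧ x 0 = x₀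

/-- The norm of `(x,u)` in `W^{1,p}_d(0,T) × L^q_m(0,T)`. -/
noncomputable def prodNorm {d m : ℕ} (T p : ℝ) (q : ℝ≥0∞)
    (x x' : ℝ → Vec d) (u : ℝ → Vec m) : ℝ :=
  (eLpNorm x (ENNReal.ofReal p) (muT T)).toReal +
    (eLpNorm x' (ENNReal.ofReal p) (muT T)).toReal + (eLpNorm u q (muT T)).toReal

/-- Points of the space `W^{1,p}_d(0,T) × L^q_m(0,T)`, represented as triples
`(x, ẋ, u)` of a trajectory, its derivative and a control. -/
abbrev Traj (d m : ℕ) := (ℝ → Vec d) × (ℝ → Vec d) × (ℝ → Vec m)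

/-- The set `A = {(x,u) : x(0) = x₀, u ∈ U}`. -/
def AsetC {d m : ℕ} (T p : ℝ) (q : ℝ≥0∞) (U : Set (ℝ → Vec m)) (x₀ : Vec d) :
    Set (Traj d m) :=
  {z | memA T p q U x₀ z.1 z.2.1 z.2.2}

/-- The feasible set `Ω` of the free-endpoint optimal control problem. -/
def OsetC {d m : ℕ} (T p : ℝ) (q : ℝ≥0∞) (U : Set (ℝ → Vec m)) (x₀ : Vec d)
    (f : Vec d → Vec m → ℝ → Vec d) : Set (Traj d m) :=
  {z ∈ AsetC T p q U x₀ | ∀ᵐ t ∂(muT T), z.2.1 t = f (z.1 t) (z.2.2 t) t}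

/-- The objective functional on triples. -/
noncomputable def IvalC {d m : ℕ} (T : ℝ) (θ : Vec d → Vec m → ℝ → ℝ) (ζ : Vec d → ℝ)
    (z : Traj d m) : ℝ :=
  objFun T θ ζ z.1 z.2.2

/-- The penalty function on triples. -/
noncomputable def PhiC {d m : ℕ} (T p : ℝ) (θ : Vec d → Vec m → ℝ → ℝ)
    (f : Vec d → Vec m → ℝ → Vec d) (ζ : Vec d → ℝ) (lam : ℝ) (z : Traj d m) : EReal :=
  penFun T p θ f ζ lam z.1 z.2.1 z.2.2

/-- The distance in `W^{1,p}_d(0,T) × L^q_m(0,T)`. -/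
noncomputable def distC {d m : ℕ} (T p : ℝ) (q : ℝ≥0∞) (z w : Traj d m) : ℝ :=
  (eLpNorm (fun t => z.1 t - w.1 t) (ENNReal.ofReal p) (muT T)).toReal +
    (eLpNorm (fun t => z.2.1 t - w.2.1 t) (ENNReal.ofReal p) (muT T)).toReal +
    (eLpNorm (fun t => z.2.2 t - w.2.2 t) q (muT T)).toReal

/-- The rate of steepest descent of `g` w.r.t. `K` at `z`, for a distance function `dd`. -/
noncomputable def rateDescentWith {Z : Type*} (dd : Z → Z → ℝ) (g : Z → EReal) (K : Set Z)
    (z : Z) : EReal :=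
  Filter.liminf (fun w => (g w - g z) * (((dd w z)⁻¹ : ℝ) : EReal))
    (⨅ (ε : ℝ) (_ : 0 < ε), Filter.principal {w | w ∈ K ∧ 0 < dd w z ∧ dd w z < ε})

theorem rateDescentWith_nonneg_iff {Z : Type*} {dd : Z → Z → ℝ} {g : Z → EReal} {G : Z → ℝ}
    {K : Set Z} {z : Z} (hg : ∀ w ∈ K, g w = (G w : EReal)) (hz : g z = (G z : EReal)) :
    (0 : EReal) ≤ rateDescentWith dd g K z ↔
      ∀ η : ℝ, 0 < η → ∃ ε : ℝ, 0 < ε ∧ ∀ w ∈ K, 0 < dd w z → dd w z < ε →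
        -η * dd w z ≤ G w - G z := by
  have hbasis : (⨅ (ε : ℝ) (_ : 0 < ε),
      Filter.principal {w | w ∈ K ∧ 0 < dd w z ∧ dd w z < ε}).HasBasis
      (fun ε : ℝ => 0 < ε) (fun ε => {w | w ∈ K ∧ 0 < dd w z ∧ dd w z < ε}) := by
    refine Filter.hasBasis_biInf_principal (s := fun ε : ℝ => {w | w ∈ K ∧ 0 < dd w z ∧ dd w z < ε})
      (S := {ε | 0 < ε}) ?_ ⟨1, show (0 : ℝ) < 1 from one_pos⟩
    intro a ha b hb
    refine ⟨min a b, show (0 : ℝ) < min a b from lt_min ha hb, ?_, ?_⟩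
    · intro w hw
      exact ⟨hw.1, hw.2.1, hw.2.2.trans_le (min_le_left _ _)⟩
    · intro w hw
      exact ⟨hw.1, hw.2.1, hw.2.2.trans_le (min_le_right _ _)⟩
  have hval : ∀ w ∈ K, (g w - g z) * (((dd w z)⁻¹ : ℝ) : EReal)
      = (((G w - G z) * (dd w z)⁻¹ : ℝ) : EReal) := by
    intro w hw
    rw [hg w hw, hz]
    push_cast
    rfl
  unfold rateDescentWith
  rw [Filter.le_liminf_iff]
  constructor
  · intro h η hη
    have h1 := h ((-η : ℝ) : EReal) (by exact_mod_cast neg_lt_zero.2 hη)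
    obtain ⟨ε, hε, hε'⟩ := hbasis.eventually_iff.1 h1
    refine ⟨ε, hε, fun w hw h0 hlt => ?_⟩
    have h2 := hε' ⟨hw, h0, hlt⟩
    rw [hval w hw, EReal.coe_lt_coe_iff, ← div_eq_mul_inv, lt_div_iff₀ h0] at h2
    exact h2.le
  · intro h y hy
    obtain ⟨r, hr1, hr2⟩ := EReal.exists_between_coe_real hy
    have hr : r < 0 := by exact_mod_cast hr2
    obtain ⟨ε, hε, hε'⟩ := h (-r) (by linarith)
    refine hbasis.eventually_iff.2 ⟨ε, hε, fun w hw => ?_⟩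
    rw [hval w hw.1]
    refine hr1.trans_le (EReal.coe_le_coe_iff.2 ?_)
    rw [← div_eq_mul_inv, le_div_iff₀ hw.2.1]
    simpa using hε' w hw.1 hw.2.1 hw.2.2

/-- Exact penalization from a uniform descent property of the penalty term and local Lipschitz
continuity of the objective. -/
theorem completely_exact_of_descent {Z : Type*} {A Ω : Set Z} {I φ : Z → ℝ}
    {Φ : ℝ → Z → EReal} {dd : Z → Z → ℝ} (hΩA : Ω ⊆ A)
    (hΦ : ∀ lam, ∀ z ∈ A, Φ lam z = ((I z + lam * φ z : ℝ) : EReal))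
    (hφ0 : ∀ z, 0 ≤ φ z) (hφΩ : ∀ z ∈ A, (φ z = 0 ↔ z ∈ Ω))
    (hd0 : ∀ z w, 0 ≤ dd w z)
    (htri : ∀ x ∈ A, ∀ y ∈ A, ∀ z ∈ A, dd x z ≤ dd x y + dd y z)
    (hdφ : ∀ z ∈ A, ∀ w ∈ A, dd w z = 0 → φ w = φ z)
    {zopt : Z} (hzopt : zopt ∈ Ω) (hmin : ∀ w ∈ Ω, I zopt ≤ I w)
    {c lam₀ b : ℝ} (hc : I zopt < c) (hlam₀ : 0 < lam₀)
    (hb : ∀ z ∈ A, b ≤ I z + lam₀ * φ z)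
    {K L ρ : ℝ} (hK : 0 < K) (hL : 0 ≤ L) (hρ : 0 < ρ)
    (hdesc : ∀ z ∈ A, I z + lam₀ * φ z < c → φ z < ρ → ∀ s : ℝ, 0 ≤ s → s ≤ 1 →
      ∃ w ∈ A, φ w = (1 - s) * φ z ∧ dd w z ≤ K * (s * φ z) ∧ I w ≤ I z + L * (s * φ z))
    (hlip : ∀ z ∈ A, ∃ M : ℝ, 0 ≤ M ∧ ∃ ε : ℝ, 0 < ε ∧ ∀ w ∈ A, dd w z < ε →
      |I w - I z| ≤ M * dd w z) :
    ∃ lamStar : ℝ, 0 ≤ lamStar ∧ ∀ lam : ℝ, lamStar ≤ lam →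
      (⨅ z ∈ A, Φ lam z) = ((I zopt : ℝ) : EReal) ∧
      ({z ∈ A | ∀ w ∈ A, Φ lam z ≤ Φ lam w} = {z ∈ Ω | ∀ w ∈ Ω, I z ≤ I w}) ∧
      (∀ z ∈ A, Φ lam z < ((c : ℝ) : EReal) →
        ((∃ ε : ℝ, 0 < ε ∧ ∀ w ∈ A, dd w z < ε → Φ lam z ≤ Φ lam w) ↔
          (z ∈ Ω ∧ ∃ ε : ℝ, 0 < ε ∧ ∀ w ∈ Ω, dd w z < ε → I z ≤ I w))) ∧
      (∀ z ∈ A, Φ lam z < ((c : ℝ) : EReal) →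
        ((0 : EReal) ≤ rateDescentWith dd (Φ lam) A z ↔
          (z ∈ Ω ∧ (0 : EReal) ≤ rateDescentWith dd (fun w => ((I w : ℝ) : EReal)) Ω z))) := by
  have hcb : 0 ≤ c - b := by
    have := hb zopt (hΩA hzopt)
    rw [(hφΩ zopt (hΩA hzopt)).2 hzopt] at this
    linarith
  refine ⟨max (L + 1) (lam₀ + (c - b) / ρ + 1), le_max_of_le_left (by linarith), ?_⟩
  intro lam hlam
  have hlamL : L + 1 ≤ lam := (le_max_left _ _).trans hlam
  have hlamρ : lam₀ + (c - b) / ρ + 1 ≤ lam := (le_max_right _ _).trans hlam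
  have hdiv : 0 ≤ (c - b) / ρ := div_nonneg hcb hρ.le
  have hlampos : 0 < lam := by linarith
  have hΩφ : ∀ z ∈ Ω, φ z = 0 := fun z hz => (hφΩ z (hΩA hz)).2 hz
  -- points of the sublevel set admit the descent property
  have hdesc' : ∀ z ∈ A, I z + lam * φ z < c → ∀ s : ℝ, 0 ≤ s → s ≤ 1 →
      ∃ w ∈ A, φ w = (1 - s) * φ z ∧ dd w z ≤ K * (s * φ z) ∧ I w ≤ I z + L * (s * φ z) := by
    intro z hz hzc
    have h1 := hb z hz
    have h2 := hφ0 z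
    refine hdesc z hz ?_ ?_
    · nlinarith
    · by_contra hcon
      push Not at hcon
      have h3 : (lam - lam₀) * φ z < c - b := by nlinarith
      have h4 : ((c - b) / ρ + 1) * ρ ≤ (lam - lam₀) * φ z := by
        apply mul_le_mul (by linarith) hcon hρ.le (by linarith)
      have h5 : ((c - b) / ρ) * ρ = c - b := by field_simp
      nlinarith
  have hproj : ∀ z ∈ A, I z + lam * φ z < c →
      ∃ w ∈ Ω, dd w z ≤ K * φ z ∧ I w ≤ I z + L * φ z := by
    intro z hz hzc
    obtain ⟨w, hwA, hw1, hw2, hw3⟩ := hdesc' z hz hzc 1 zero_le_one le_rfl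
    refine ⟨w, (hφΩ w hwA).1 (by rw [hw1]; ring), by simpa using hw2, by simpa using hw3⟩
  have hlow : ∀ z ∈ A, I zopt + φ z ≤ I z + lam * φ z ∨ c ≤ I z + lam * φ z := by
    intro z hz
    rcases lt_or_ge (I z + lam * φ z) c with h | h
    · left
      obtain ⟨w, hw, -, hw2⟩ := hproj z hz h
      have := hmin w hw
      nlinarith [hφ0 z]
    · exact Or.inr h
  have hlow' : ∀ z ∈ A, I zopt ≤ I z + lam * φ z := by
    intro z hz
    rcases hlow z hz with h | h
    · linarith [hφ0 z]
    · linarith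
  -- near a feasible point, points with smaller penalty value project to close feasible points
  have hnear : ∀ z ∈ Ω, I z < c → ∃ C : ℝ, 0 < C ∧ ∃ ε : ℝ, 0 < ε ∧ ∀ w ∈ A, dd w z < ε →
      I w + lam * φ w < I z →
      ∃ v ∈ Ω, dd v z ≤ C * dd w z ∧ I v ≤ I w + lam * φ w := by
    intro z hz hzc
    obtain ⟨M, hM, ε, hε, hlipz⟩ := hlip z (hΩA hz)
    refine ⟨1 + K * (M / lam), by positivity, ε, hε, fun w hw hwd hwI => ?_⟩
    obtain ⟨v, hv, hv1, hv2⟩ := hproj w hw (hwI.trans hzc)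
    have h1 := (abs_le.1 (hlipz w hw hwd)).1
    have h2 : φ w ≤ M / lam * dd w z := by
      rw [div_mul_eq_mul_div, le_div_iff₀ hlampos]
      nlinarith
    refine ⟨v, hv, ?_, ?_⟩
    · have h3 := htri v (hΩA hv) w hw z (hΩA hz)
      have h4 := mul_le_mul_of_nonneg_left h2 hK.le
      nlinarith
    · nlinarith [hφ0 w]
  refine ⟨?_, ?_, ?_, ?_⟩
  · apply le_antisymm
    · refine (iInf₂_le zopt (hΩA hzopt)).trans ?_
      rw [hΦ lam zopt (hΩA hzopt), hΩφ zopt hzopt]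
      simp
    · refine le_iInf₂ fun z hz => ?_
      rw [hΦ lam z hz]
      exact EReal.coe_le_coe_iff.2 (hlow' z hz)
  · ext z
    simp only [Set.mem_ofPred_eq]
    constructor
    · rintro ⟨hz, hzm⟩
      have h1 := hzm zopt (hΩA hzopt)
      rw [hΦ lam z hz, hΦ lam zopt (hΩA hzopt), hΩφ zopt hzopt, EReal.coe_le_coe_iff] at h1
      have h2 : φ z = 0 := by
        rcases hlow z hz with h | h
        · linarith [hφ0 z]
        · linarith
      refine ⟨(hφΩ z hz).1 h2, fun w hw => ?_⟩
      rw [h2] at h1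
      linarith [hmin w hw]
    · rintro ⟨hz, hzm⟩
      refine ⟨hΩA hz, fun w hw => ?_⟩
      rw [hΦ lam z (hΩA hz), hΦ lam w hw, hΩφ z hz, EReal.coe_le_coe_iff]
      linarith [hzm zopt hzopt, hlow' w hw]
  · intro z hz hzc
    rw [hΦ lam z hz, EReal.coe_lt_coe_iff] at hzc
    constructor
    · rintro ⟨ε, hε, hloc⟩
      have hzΩ : z ∈ Ω := by
        rw [← hφΩ z hz]
        by_contra hne
        have hpos : 0 < φ z := lt_of_le_of_ne (hφ0 z) (Ne.symm hne)
        obtain ⟨s, hs0, hs⟩ : ∃ s : ℝ, 0 < s ∧ K * (s * φ z) < ε := by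
          refine ⟨ε / (2 * (K * φ z)), by positivity, ?_⟩
          have : K * (ε / (2 * (K * φ z)) * φ z) = ε / 2 := by field_simp
          linarith
        have hs' : 0 < min s 1 := lt_min hs0 one_pos
        obtain ⟨w, hwA, hw1, hw2, hw3⟩ := hdesc' z hz hzc (min s 1) hs'.le (min_le_right _ _)
        have h1 : K * (min s 1 * φ z) ≤ K * (s * φ z) := by
          gcongr
          exact min_le_left _ _
        have h2 := hloc w hwA (by linarith)
        rw [hΦ lam z hz, hΦ lam w hwA, EReal.coe_le_coe_iff, hw1] at h2
        have h3 : 0 < min s 1 * φ z := by positivity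
        nlinarith
      refine ⟨hzΩ, ε, hε, fun w hw hwd => ?_⟩
      have h1 := hloc w (hΩA hw) hwd
      rw [hΦ lam z hz, hΦ lam w (hΩA hw), EReal.coe_le_coe_iff, hΩφ z hzΩ, hΩφ w hw] at h1
      linarith
    · rintro ⟨hzΩ, ε, hε, hloc⟩
      rw [hΩφ z hzΩ] at hzc
      obtain ⟨C, hC, ε', hε', hn⟩ := hnear z hzΩ (by linarith)
      refine ⟨min ε' (ε / C), lt_min hε' (by positivity), fun w hw hwd => ?_⟩
      rw [hΦ lam z hz, hΦ lam w hw, EReal.coe_le_coe_iff, hΩφ z hzΩ]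
      by_contra hcon
      push Not at hcon
      obtain ⟨v, hv, hv1, hv2⟩ := hn w hw (hwd.trans_le (min_le_left _ _)) (by linarith)
      have h1 : dd w z < ε / C := hwd.trans_le (min_le_right _ _)
      rw [lt_div_iff₀ hC] at h1
      have h2 := hloc v hv (by linarith)
      linarith
  · intro z hz hzc
    rw [hΦ lam z hz, EReal.coe_lt_coe_iff] at hzc
    rw [rateDescentWith_nonneg_iff (G := fun w => I w + lam * φ w) (hΦ lam) (hΦ lam z hz),
      rateDescentWith_nonneg_iff (G := I) (fun _ _ => rfl) rfl]
    constructor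
    · intro hstat
      have hzΩ : z ∈ Ω := by
        rw [← hφΩ z hz]
        by_contra hne
        have hpos : 0 < φ z := lt_of_le_of_ne (hφ0 z) (Ne.symm hne)
        obtain ⟨ε, hε, hε'⟩ := hstat (1 / (2 * K)) (by positivity)
        obtain ⟨s, hs0, hs⟩ : ∃ s : ℝ, 0 < s ∧ K * (s * φ z) < ε := by
          refine ⟨ε / (2 * (K * φ z)), by positivity, ?_⟩
          have : K * (ε / (2 * (K * φ z)) * φ z) = ε / 2 := by field_simp
          linarith
        have hs' : 0 < min s 1 := lt_min hs0 one_pos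
        obtain ⟨w, hwA, hw1, hw2, hw3⟩ := hdesc' z hz hzc (min s 1) hs'.le (min_le_right _ _)
        have h1 : K * (min s 1 * φ z) ≤ K * (s * φ z) := by
          gcongr
          exact min_le_left _ _
        have h3 : 0 < min s 1 * φ z := by positivity
        have hdpos : 0 < dd w z := by
          refine lt_of_le_of_ne (hd0 z w) fun h => ?_
          have := hdφ z hz w hwA h.symm
          rw [hw1] at this
          linarith
        have h2 := hε' w hwA hdpos (by linarith)
        have h4 : 1 / (2 * K) * dd w z ≤ 1 / (2 * K) * (K * (min s 1 * φ z)) := by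
          gcongr
        have h5 : 1 / (2 * K) * (K * (min s 1 * φ z)) = min s 1 * φ z / 2 := by
          field_simp
        rw [hw1] at h2
        nlinarith
      refine ⟨hzΩ, fun η hη => ?_⟩
      obtain ⟨ε, hε, hε'⟩ := hstat η hη
      refine ⟨ε, hε, fun w hw h0 h1 => ?_⟩
      have := hε' w (hΩA hw) h0 h1
      rw [hΩφ z hzΩ, hΩφ w hw] at this
      linarith
    · rintro ⟨hzΩ, hstat⟩ η hη
      rw [hΩφ z hzΩ] at hzc
      obtain ⟨M, hM, ε₁, hε₁, hlipz⟩ := hlip z hz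
      obtain ⟨C, hC, ε', hε', hn⟩ := hnear z hzΩ (by linarith)
      obtain ⟨ε, hε, hloc⟩ := hstat (η / C) (by positivity)
      refine ⟨min ε' (min ε ε₁ / C), lt_min hε' (div_pos (lt_min hε hε₁) hC),
        fun w hw h0 hwd => ?_⟩
      rw [hΩφ z hzΩ]
      have hηd : 0 ≤ η * dd w z := by positivity
      by_contra hcon
      push Not at hcon
      obtain ⟨v, hv, hv1, hv2⟩ := hn w hw (hwd.trans_le (min_le_left _ _)) (by linarith)
      have h1 : dd w z < min ε ε₁ / C := hwd.trans_le (min_le_right _ _)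
      rw [lt_div_iff₀ hC] at h1
      have h2 : dd v z < min ε ε₁ := by linarith
      have h3 : I z - η * dd w z ≤ I v := by
        rcases (hd0 z v).eq_or_lt with h | h
        · have := hlipz v (hΩA hv) (h2.trans_le (min_le_right _ _))
          rw [← h, mul_zero] at this
          have := (abs_le.1 this).1
          linarith
        · have h4 := hloc v hv h (h2.trans_le (min_le_left _ _))
          have h5 : η / C * dd v z ≤ η / C * (C * dd w z) := by gcongr
          have h6 : η / C * (C * dd w z) = η * dd w z := by field_simp
          linarith
      linarith


/-- Solvability of the integral equation `y(t) = x₀ + ∫₀ᵗ g(s, y(s)) ds` near an approximate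
solution `x`, with an error estimate in an exponentially weighted norm. -/
theorem exists_integral_equation_near {E : Type*} [NormedAddCommGroup E] [NormedSpace ℝ E]
    [CompleteSpace E] {T : ℝ} {g : ℝ → E → E} {x : ℝ → E} {x₀ : E} {L : ℝ → ℝ} {k ε : ℝ}
    (hT : 0 ≤ T) (hk : 0 ≤ k) (hε : 0 ≤ ε)
    (hxc : ContinuousOn x (Icc 0 T))
    (hint : ∀ y : ℝ → E, ContinuousOn y (Icc 0 T) → (∀ t ∈ Icc 0 T, ‖y t - x t‖ ≤ 1) →
      IntervalIntegrable (fun t => g t (y t)) volume 0 T)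
    (hL : IntervalIntegrable (fun s => L s * Real.exp (k * s)) volume 0 T)
    (hL0 : ∀ᵐ t, t ∈ Ioc 0 T → 0 ≤ L t)
    (hLip : ∀ᵐ t, t ∈ Ioc 0 T → ∀ a b : E, ‖a - x t‖ ≤ 1 → ‖b - x t‖ ≤ 1 →
      ‖g t a - g t b‖ ≤ L t * ‖a - b‖)
    (hLk : ∀ t ∈ Icc 0 T, ∫ s in (0:ℝ)..t, L s * Real.exp (k * s) ≤ Real.exp (k * t) / 2)
    (hx : ∀ t ∈ Icc 0 T, ‖x₀ + (∫ s in (0:ℝ)..t, g s (x s)) - x t‖ ≤ ε)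
    (hsmall : 2 * ε * Real.exp (k * T) ≤ 1) :
    ∃ y : ℝ → E, ContinuousOn y (Icc 0 T) ∧
      (∀ t ∈ Icc 0 T, y t = x₀ + ∫ s in (0:ℝ)..t, g s (y s)) ∧
      ∀ t ∈ Icc 0 T, ‖y t - x t‖ ≤ 2 * ε * Real.exp (k * t) := by
  have htube : ∀ t ∈ Icc 0 T, 2 * ε * Real.exp (k * t) ≤ 1 := by
    intro t ht
    refine le_trans ?_ hsmall
    have : k * t ≤ k * T := mul_le_mul_of_nonneg_left ht.2 hk
    gcongr
  have hsub : ∀ t ∈ Icc 0 T, ∀ h : ℝ → E, IntervalIntegrable h volume 0 T →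
      IntervalIntegrable h volume 0 t := by
    intro t ht h hh
    refine hh.mono_set ?_
    rw [uIcc_of_le ht.1, uIcc_of_le hT]
    exact Icc_subset_Icc_right ht.2
  have hsubL : ∀ t ∈ Icc 0 T,
      IntervalIntegrable (fun s => L s * Real.exp (k * s)) volume 0 t := by
    intro t ht
    refine hL.mono_set ?_
    rw [uIcc_of_le ht.1, uIcc_of_le hT]
    exact Icc_subset_Icc_right ht.2
  have hcontr : ∀ y z : ℝ → E, ContinuousOn y (Icc 0 T) → ContinuousOn z (Icc 0 T) →
      (∀ t ∈ Icc 0 T, ‖y t - x t‖ ≤ 1) → (∀ t ∈ Icc 0 T, ‖z t - x t‖ ≤ 1) → ∀ D : ℝ, 0 ≤ D →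
      (∀ t ∈ Icc 0 T, ‖y t - z t‖ ≤ D * Real.exp (k * t)) →
      ∀ t ∈ Icc 0 T, ‖(∫ s in (0:ℝ)..t, g s (y s)) - ∫ s in (0:ℝ)..t, g s (z s)‖
        ≤ D / 2 * Real.exp (k * t) := by
    intro y z hyc hzc hy hz D hD hyz t ht
    rw [← intervalIntegral.integral_sub (hsub t ht _ (hint y hyc hy)) (hsub t ht _ (hint z hzc hz))]
    calc _ ≤ ∫ s in (0:ℝ)..t, D * (L s * Real.exp (k * s)) := by
          refine intervalIntegral.norm_integral_le_of_norm_le ht.1 ?_ ((hsubL t ht).const_mul D)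
          filter_upwards [hL0, hLip] with s h1 h2 hs
          have hs' : s ∈ Ioc 0 T := ⟨hs.1, hs.2.trans ht.2⟩
          have hs'' : s ∈ Icc 0 T := Ioc_subset_Icc_self hs'
          calc _ ≤ L s * ‖y s - z s‖ := h2 hs' _ _ (hy s hs'') (hz s hs'')
            _ ≤ L s * (D * Real.exp (k * s)) :=
              mul_le_mul_of_nonneg_left (hyz s hs'') (h1 hs')
            _ = _ := by ring
      _ = D * ∫ s in (0:ℝ)..t, L s * Real.exp (k * s) := intervalIntegral.integral_const_mul _ _
      _ ≤ D * (Real.exp (k * t) / 2) := mul_le_mul_of_nonneg_left (hLk t ht) hD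
      _ = _ := by ring
  set F : (ℝ → E) → ℝ → E := fun y t => x₀ + ∫ s in (0:ℝ)..t, g s (y s) with hF
  set Y : ℕ → ℝ → E := fun n => F^[n] x with hY
  have hY1 : ∀ n, Y (n + 1) = F (Y n) := fun n => Function.iterate_succ_apply' F n x
  have hxx : ∀ t ∈ Icc 0 T, ‖x t - x t‖ ≤ 1 := by simp
  have hFc : ∀ y : ℝ → E, ContinuousOn y (Icc 0 T) → (∀ t ∈ Icc 0 T, ‖y t - x t‖ ≤ 1) →
      ContinuousOn (F y) (Icc 0 T) := by
    intro y hyc hy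
    refine continuousOn_const.add ?_
    have := intervalIntegral.continuousOn_primitive_interval' (hint y hyc hy)
      (left_mem_uIcc)
    rwa [uIcc_of_le hT] at this
  have hx1 : ∀ t ∈ Icc 0 T, ‖F x t - x t‖ ≤ ε * Real.exp (k * t) := by
    intro t ht
    refine (hx t ht).trans ?_
    have : (1:ℝ) ≤ Real.exp (k * t) := Real.one_le_exp (mul_nonneg hk ht.1)
    nlinarith
  have hYtube : ∀ n, ContinuousOn (Y n) (Icc 0 T) ∧
      ∀ t ∈ Icc 0 T, ‖Y n t - x t‖ ≤ 2 * ε * Real.exp (k * t) := by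
    intro n
    induction n with
    | zero =>
      refine ⟨hxc, fun t ht => ?_⟩
      simp only [hY, Function.iterate_zero, id, sub_self, norm_zero]
      positivity
    | succ n ih =>
      have h1 : ∀ t ∈ Icc 0 T, ‖Y n t - x t‖ ≤ 1 := fun t ht => (ih.2 t ht).trans (htube t ht)
      refine ⟨by rw [hY1]; exact hFc _ ih.1 h1, fun t ht => ?_⟩
      rw [hY1]
      have h2 := hcontr (Y n) x ih.1 hxc h1 hxx (2 * ε) (by positivity) ih.2 t ht
      have h3 : F (Y n) t - x t = ((∫ s in (0:ℝ)..t, g s (Y n s)) - ∫ s in (0:ℝ)..t, g s (x s))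
          + (F x t - x t) := by simp only [hF]; abel
      rw [h3]
      refine (norm_add_le _ _).trans ?_
      linarith [hx1 t ht]
  have hY1' : ∀ n, ∀ t ∈ Icc 0 T, ‖Y n t - x t‖ ≤ 1 :=
    fun n t ht => ((hYtube n).2 t ht).trans (htube t ht)
  have hstep : ∀ n, ∀ t ∈ Icc 0 T, ‖Y n t - Y (n + 1) t‖ ≤ ε / 2 ^ n * Real.exp (k * t) := by
    intro n
    induction n with
    | zero =>
      intro t ht
      rw [norm_sub_rev]
      simpa [hY] using hx1 t ht
    | succ n ih =>
      intro t ht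
      have h2 := hcontr (Y n) (Y (n + 1)) (hYtube n).1 (hYtube (n + 1)).1 (hY1' n) (hY1' (n + 1))
        (ε / 2 ^ n) (by positivity) ih t ht
      have h3 : Y (n + 1) t - Y (n + 1 + 1) t
          = (∫ s in (0:ℝ)..t, g s (Y n s)) - ∫ s in (0:ℝ)..t, g s (Y (n + 1) s) := by
        rw [hY1 (n + 1), hY1 n]
        simp only [hF]
        abel
      rw [h3]
      refine h2.trans (le_of_eq ?_)
      rw [pow_succ]
      field_simp
  have hgeo : ∀ t ∈ Icc 0 T, ∀ n, dist (Y n t) (Y (n + 1) t) ≤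
      (2 * ε * Real.exp (k * t)) / 2 / 2 ^ n := by
    intro t ht n
    rw [dist_eq_norm]
    refine (hstep n t ht).trans (le_of_eq ?_)
    field_simp
  have hlim : ∀ t, ∃ l, t ∈ Icc 0 T → Tendsto (fun n => Y n t) atTop (𝓝 l) := by
    intro t
    by_cases ht : t ∈ Icc 0 T
    · obtain ⟨l, hl⟩ := cauchySeq_tendsto_of_complete (cauchySeq_of_le_geometric_two (hgeo t ht))
      exact ⟨l, fun _ => hl⟩
    · exact ⟨0, fun h => absurd h ht⟩
  choose y hy using hlim
  have hdist : ∀ n, ∀ t ∈ Icc 0 T, ‖Y n t - y t‖ ≤ 2 * ε / 2 ^ n * Real.exp (k * t) := by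
    intro n t ht
    have := dist_le_of_le_geometric_two_of_tendsto (hgeo t ht) (hy t ht) n
    rw [dist_eq_norm] at this
    refine this.trans (le_of_eq ?_)
    ring
  have hpow : Tendsto (fun n : ℕ => 1 / (2:ℝ) ^ n) atTop (𝓝 0) := by
    simpa using tendsto_pow_atTop_nhds_zero_of_lt_one (r := (1/2 : ℝ)) (by norm_num) (by norm_num)
  have hyc : ContinuousOn y (Icc 0 T) := by
    have hunif : TendstoUniformlyOn Y y atTop (Icc 0 T) := by
      rw [Metric.tendstoUniformlyOn_iff]
      intro e he
      filter_upwards [hpow.eventually (gt_mem_nhds he)] with n hn t ht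
      rw [dist_comm, dist_eq_norm]
      refine (hdist n t ht).trans_lt (lt_of_le_of_lt ?_ hn)
      have h1 := htube t ht
      calc 2 * ε / 2 ^ n * Real.exp (k * t) = (2 * ε * Real.exp (k * t)) * (1 / 2 ^ n) := by ring
        _ ≤ 1 * (1 / 2 ^ n) := by gcongr
        _ = _ := one_mul _
    exact hunif.continuousOn (Frequently.of_forall fun n => (hYtube n).1)
  have hytube : ∀ t ∈ Icc 0 T, ‖y t - x t‖ ≤ 2 * ε * Real.exp (k * t) := by
    intro t ht
    have := hdist 0 t ht
    rw [norm_sub_rev] at this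
    simpa [hY] using this
  have hytube1 : ∀ t ∈ Icc 0 T, ‖y t - x t‖ ≤ 1 := fun t ht => (hytube t ht).trans (htube t ht)
  refine ⟨y, hyc, fun t ht => ?_, hytube⟩
  have h1 : Tendsto (fun n => Y (n + 1) t) atTop (𝓝 (y t)) :=
    (hy t ht).comp (tendsto_add_atTop_nat 1)
  have h2 : Tendsto (fun n => Y (n + 1) t) atTop (𝓝 (F y t)) := by
    rw [tendsto_iff_norm_sub_tendsto_zero]
    refine squeeze_zero (fun _ => norm_nonneg _) (fun n => ?_)
      (by simpa using hpow)
    have h3 := hcontr (Y n) y (hYtube n).1 hyc (hY1' n) hytube1 (2 * ε / 2 ^ n) (by positivity)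
      (hdist n) t ht
    have h4 : Y (n + 1) t - F y t
        = (∫ s in (0:ℝ)..t, g s (Y n s)) - ∫ s in (0:ℝ)..t, g s (y s) := by
      rw [hY1]
      simp only [hF]
      abel
    rw [h4]
    refine h3.trans ?_
    have h5 := htube t ht
    calc 2 * ε / 2 ^ n / 2 * Real.exp (k * t)
        = (2 * ε * Real.exp (k * t)) * ((1 / 2 ^ n) / 2) := by ring
      _ ≤ 1 * ((1 / 2 ^ n) / 2) := by gcongr
      _ ≤ 1 / 2 ^ n := by
        have : (0:ℝ) < 1 / 2 ^ n := by positivity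
        linarith
      _ = ((2:ℝ) ^ n)⁻¹ := one_div _
  exact tendsto_nhds_unique h1 h2


instance isFiniteMeasure_muT (T : ℝ) : IsFiniteMeasure (muT T) := by
  unfold muT
  infer_instance

theorem muT_univ (T : ℝ) : muT T univ = ENNReal.ofReal T := by
  simp [muT]

theorem muT_mono {t T : ℝ} (h : t ≤ T) : muT t ≤ muT T :=
  Measure.restrict_mono (Ioc_subset_Ioc_right h) le_rfl

theorem ae_muT_mem (T : ℝ) : ∀ᵐ t ∂(muT T), t ∈ Ioc 0 T :=
  ae_restrict_mem measurableSet_Ioc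

theorem ae_muT_iff {T : ℝ} {P : ℝ → Prop} :
    (∀ᵐ t ∂(muT T), P t) ↔ ∀ᵐ t, t ∈ Ioc 0 T → P t :=
  ae_restrict_iff' measurableSet_Ioc

theorem integrable_muT_iff {E : Type*} [NormedAddCommGroup E] {T : ℝ} (hT : 0 ≤ T) {h : ℝ → E} :
    Integrable h (muT T) ↔ IntervalIntegrable h volume 0 T :=
  (intervalIntegrable_iff_integrableOn_Ioc_of_le hT).symm

/-- Hölder's inequality for the product of two real functions, in terms of `eLpNorm`. -/
theorem integrable_mul_and_integral_mul_le {α : Type*} {mα : MeasurableSpace α} {μ : Measure α}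
    {p r : ℝ≥0∞} (hpr : p⁻¹ + r⁻¹ = 1) {g h : α → ℝ} (hg : MemLp g p μ) (hh : MemLp h r μ) :
    Integrable (fun t => g t * h t) μ ∧
      ∫ t, g t * h t ∂μ ≤ (eLpNorm g p μ).toReal * (eLpNorm h r μ).toReal := by
  have : ENNReal.HolderConjugate p r := ENNReal.holderConjugate_iff.2 hpr
  have hint : Integrable (fun t => g t * h t) μ := hg.integrable_mul hh
  refine ⟨hint, ?_⟩
  have h1 : eLpNorm (g • h) 1 μ ≤ eLpNorm g p μ * eLpNorm h r μ :=
    eLpNorm_smul_le_mul_eLpNorm hh.1 hg.1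
  calc ∫ t, g t * h t ∂μ ≤ ∫ t, ‖g t * h t‖ ∂μ :=
        integral_mono hint hint.norm fun t => Real.le_norm_self _
    _ = (eLpNorm (g • h) 1 μ).toReal := by
        rw [integral_norm_eq_lintegral_enorm hint.1, eLpNorm_one_eq_lintegral_enorm]
        rfl
    _ ≤ (eLpNorm g p μ * eLpNorm h r μ).toReal :=
        ENNReal.toReal_mono (ENNReal.mul_ne_top hg.2.ne hh.2.ne) h1
    _ = _ := ENNReal.toReal_mul

theorem eLpNorm_exp_mul_le {k r t : ℝ} (hk : 0 < k) (hr : 1 < r) (ht : 0 ≤ t) :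
    (eLpNorm (fun s => Real.exp (k * s)) (ENNReal.ofReal r) (muT t)).toReal
      ≤ Real.exp (k * t) / (k * r) ^ r⁻¹ := by
  have hr0 : 0 < r := by linarith
  have hmem : MemLp (fun s => Real.exp (k * s)) (ENNReal.ofReal r) (muT t) := by
    refine MemLp.of_bound (by fun_prop) (Real.exp (k * t)) ?_
    filter_upwards [ae_muT_mem t] with s hs
    rw [Real.norm_eq_abs, Real.abs_exp, Real.exp_le_exp]
    exact mul_le_mul_of_nonneg_left hs.2 hk.le
  rw [hmem.eLpNorm_eq_integral_rpow_norm (by simpa using hr0) ENNReal.ofReal_ne_top,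
    ENNReal.toReal_ofReal (by positivity), ENNReal.toReal_ofReal hr0.le]
  have h1 : ∫ s, ‖Real.exp (k * s)‖ ^ r ∂(muT t) = (Real.exp (k * r * t) - 1) / (k * r) := by
    have : ∀ s : ℝ, ‖Real.exp (k * s)‖ ^ r = Real.exp (k * r * s) := by
      intro s
      rw [Real.norm_eq_abs, Real.abs_exp, ← Real.exp_mul]
      congr 1
      ring
    simp_rw [this, muT]
    rw [← intervalIntegral.integral_of_le ht,
      intervalIntegral.integral_comp_mul_left (fun s => Real.exp s) (by positivity), integral_exp]
    simp only [mul_zero, Real.exp_zero, smul_eq_mul]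
    ring
  rw [h1]
  have h3 : 0 ≤ Real.exp (k * r * t) - 1 := by
    have := Real.one_le_exp (x := k * r * t) (by positivity)
    linarith
  calc ((Real.exp (k * r * t) - 1) / (k * r)) ^ r⁻¹
      ≤ (Real.exp (k * r * t) / (k * r)) ^ r⁻¹ := by
        gcongr
        linarith
    _ = Real.exp (k * r * t) ^ r⁻¹ / (k * r) ^ r⁻¹ :=
        Real.div_rpow (Real.exp_pos _).le (by positivity) _
    _ = _ := by
        rw [← Real.exp_mul]
        congr 2
        field_simp

/-- A uniform exponential weight making integration against functions bounded in `L^p`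
a contraction. -/
theorem exists_exp_weight {T p M : ℝ} (hp : 1 < p) (hM : 0 ≤ M) :
    ∃ k : ℝ, 0 < k ∧ ∀ L : ℝ → ℝ, MemLp L (ENNReal.ofReal p) (muT T) →
      (eLpNorm L (ENNReal.ofReal p) (muT T)).toReal ≤ M →
      ∀ t ∈ Icc 0 T, ∫ s in (0:ℝ)..t, L s * Real.exp (k * s) ≤ Real.exp (k * t) / 2 := by
  have hpr := Real.HolderConjugate.conjExponent hp
  set r := p.conjExponent with hr
  have hr1 : 1 < r := hpr.symm.lt
  have hr0 : 0 < r := by linarith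
  refine ⟨(2 * M + 1) ^ r / r, by positivity, fun L hL hLM t ht => ?_⟩
  set k := (2 * M + 1) ^ r / r with hk
  have hk0 : 0 < k := by positivity
  have hkr : (k * r) ^ r⁻¹ = 2 * M + 1 := by
    rw [hk, div_mul_cancel₀ _ hr0.ne', Real.rpow_rpow_inv (by positivity) hr0.ne']
  have hLt : MemLp L (ENNReal.ofReal p) (muT t) := hL.mono_measure (muT_mono ht.2)
  have hexp : MemLp (fun s => Real.exp (k * s)) (ENNReal.ofReal r) (muT t) := by
    refine MemLp.of_bound (by fun_prop) (Real.exp (k * t)) ?_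
    filter_upwards [ae_muT_mem t] with s hs
    rw [Real.norm_eq_abs, Real.abs_exp, Real.exp_le_exp]
    exact mul_le_mul_of_nonneg_left hs.2 hk0.le
  have h1 := (integrable_mul_and_integral_mul_le
    (ENNReal.holderConjugate_iff.1 hpr.ennrealOfReal) hLt hexp).2
  have h2 := eLpNorm_exp_mul_le hk0 hr1 ht.1
  have h3 : (eLpNorm L (ENNReal.ofReal p) (muT t)).toReal ≤ M :=
    (ENNReal.toReal_mono hL.2.ne (eLpNorm_mono_measure _ (muT_mono ht.2))).trans hLM
  rw [hkr] at h2
  rw [intervalIntegral.integral_of_le ht.1]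
  refine h1.trans ?_
  calc _ ≤ M * (Real.exp (k * t) / (2 * M + 1)) := by gcongr
    _ = (M / (2 * M + 1)) * Real.exp (k * t) := by ring
    _ ≤ (1 / 2) * Real.exp (k * t) := by
        refine mul_le_mul_of_nonneg_right ?_ (Real.exp_pos _).le
        rw [div_le_div_iff₀ (by positivity) (by norm_num)]
        linarith
    _ = _ := by ring

/-- The `L¹` norm on `(0,T)` is controlled by the `L^p` norm. -/
theorem exists_integral_norm_le {T p : ℝ} (hp : 1 < p) :
    ∃ κ : ℝ, 0 < κ ∧ ∀ {E : Type} [NormedAddCommGroup E] (h : ℝ → E),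
      MemLp h (ENNReal.ofReal p) (muT T) →
      ∫ t, ‖h t‖ ∂(muT T) ≤ κ * (eLpNorm h (ENNReal.ofReal p) (muT T)).toReal := by
  have hpr := Real.HolderConjugate.conjExponent hp
  refine ⟨(eLpNorm (fun _ => (1:ℝ)) (ENNReal.ofReal p.conjExponent) (muT T)).toReal + 1,
    by positivity, ?_⟩
  intro E _ h hh
  have h1 := (integrable_mul_and_integral_mul_le
    (ENNReal.holderConjugate_iff.1 hpr.ennrealOfReal) hh.norm (memLp_const (1:ℝ))).2
  simp only [mul_one, eLpNorm_norm] at h1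
  nlinarith [ENNReal.toReal_nonneg (a := eLpNorm h (ENNReal.ofReal p) (muT T))]

/-- Continuous Carathéodory-type superpositions are measurable. -/
theorem aestronglyMeasurable_superposition {d m : ℕ} {F : Type*} [NormedAddCommGroup F]
    {T : ℝ} (hT : 0 ≤ T) {h : Vec d → Vec m → ℝ → F}
    (hc : ContinuousOn (fun z : Vec d × Vec m × ℝ => h z.1 z.2.1 z.2.2)
      (Set.univ ×ˢ Set.univ ×ˢ Set.Icc 0 T))
    {x : ℝ → Vec d} {u : ℝ → Vec m} (hx : ContinuousOn x (Icc 0 T))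
    (hu : AEStronglyMeasurable u (muT T)) :
    AEStronglyMeasurable (fun t => h (x t) (u t) t) (muT T) := by
  have hx' : AEStronglyMeasurable x (muT T) :=
    (hx.mono Ioc_subset_Icc_self).aestronglyMeasurable measurableSet_Ioc
  have hcont : Continuous (fun z : Vec d × Vec m × ℝ => h z.1 z.2.1 (projIcc 0 T hT z.2.2)) := by
    have h1 : Continuous (fun z : Vec d × Vec m × ℝ =>
        ((z.1, z.2.1, (projIcc 0 T hT z.2.2 : ℝ)) : Vec d × Vec m × ℝ)) := by
      have : Continuous (fun t : ℝ => (projIcc 0 T hT t : ℝ)) :=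
        continuous_subtype_val.comp continuous_projIcc
      fun_prop
    exact hc.comp_continuous h1 fun z => ⟨trivial, trivial, (projIcc 0 T hT z.2.2).2⟩
  have h2 : AEStronglyMeasurable (fun t => (x t, u t, t)) (muT T) :=
    hx'.prodMk (hu.prodMk aestronglyMeasurable_id)
  refine (hcont.comp_aestronglyMeasurable h2).congr ?_
  filter_upwards [ae_muT_mem T] with t ht
  simp [projIcc_of_mem hT (Ioc_subset_Icc_self ht)]

/-- Uniform `L^s` majorants for superpositions with arguments bounded in `L^∞ × L^q`. -/
def HasMajorants {d m : ℕ} {F : Type*} [NormedAddCommGroup F] (T : ℝ) (q s : ℝ≥0∞)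
    (h : Vec d → Vec m → ℝ → F) : Prop :=
  ∀ R : ℝ, 0 < R → ∃ M : ℝ, 0 ≤ M ∧ ∀ β : ℝ → ℝ, AEStronglyMeasurable β (muT T) →
    eLpNorm β q (muT T) ≤ ENNReal.ofReal R →
    ∃ G : ℝ → ℝ, MemLp G s (muT T) ∧ (∀ t, 0 ≤ G t) ∧
      (eLpNorm G s (muT T)).toReal ≤ M ∧
      ∀ᵐ t ∂(muT T), ∀ (a : Vec d) (b : Vec m), ‖a‖ ≤ R → ‖b‖ ≤ β t → ‖h a b t‖ ≤ G t

theorem hasMajorants_top {d m : ℕ} {F : Type*} [NormedAddCommGroup F] {T : ℝ} {s : ℝ≥0∞}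
    {h : Vec d → Vec m → ℝ → F}
    (hc : ContinuousOn (fun z : Vec d × Vec m × ℝ => h z.1 z.2.1 z.2.2)
      (Set.univ ×ˢ Set.univ ×ˢ Set.Icc 0 T)) :
    HasMajorants T ⊤ s h := by
  intro R hR
  have hcomp : IsCompact (Metric.closedBall (0 : Vec d) R ×ˢ Metric.closedBall (0 : Vec m) R ×ˢ
      Icc 0 T) :=
    (isCompact_closedBall _ _).prod ((isCompact_closedBall _ _).prod isCompact_Icc)
  obtain ⟨C, hC⟩ := hcomp.exists_bound_of_continuousOn (hc.mono (by
    rintro ⟨a, b, t⟩ ⟨-, -, ht⟩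
    exact ⟨trivial, trivial, ht⟩))
  refine ⟨(eLpNorm (fun _ => |C|) s (muT T)).toReal, by positivity, fun β _ hβ => ?_⟩
  refine ⟨fun _ => |C|, memLp_const _, fun _ => abs_nonneg _, le_rfl, ?_⟩
  rw [eLpNorm_exponent_top] at hβ
  filter_upwards [ae_muT_mem T, ae_le_eLpNormEssSup (f := β) (μ := muT T)] with t ht h1 a b ha hb
  have h2 : ‖β t‖ ≤ R := by
    have := h1.trans hβ
    rwa [← ofReal_norm, ENNReal.ofReal_le_ofReal_iff hR.le] at this
  refine (hC (a, b, t) ⟨by simpa using ha, ?_, Ioc_subset_Icc_self ht⟩).trans (le_abs_self C)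
  simpa using hb.trans ((Real.le_norm_self _).trans h2)

theorem hasMajorants_of_growth {d m : ℕ} {F : Type*} [NormedAddCommGroup F] {T : ℝ}
    {q s : ℝ≥0∞} {l : ℝ} (hs : 1 ≤ s) (hl : l = 0 ∨ 0 < l ∧ s * ENNReal.ofReal l = q)
    {h : Vec d → Vec m → ℝ → F}
    (hg : ∀ R : ℝ, 0 < R → ∃ C : ℝ, 0 < C ∧ ∃ ω : ℝ → ℝ,
      MemLp ω s (muT T) ∧ (∀ᵐ t ∂(muT T), 0 ≤ ω t) ∧
      ∀ᵐ t ∂(muT T), ∀ (a : Vec d) (b : Vec m), ‖a‖ ≤ R → ‖h a b t‖ ≤ C * ‖b‖ ^ l + ω t) :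
    HasMajorants T q s h := by
  intro R hR
  obtain ⟨C, hC, ω, hω, hω0, hb⟩ := hg R hR
  have hl0 : 0 ≤ l := by rcases hl with h | h <;> linarith [h]
  obtain ⟨B, hB, hBβ⟩ : ∃ B : ℝ≥0∞, B ≠ ⊤ ∧ ∀ β : ℝ → ℝ,
      eLpNorm β q (muT T) ≤ ENNReal.ofReal R → eLpNorm (fun t => ‖β t‖ ^ l) s (muT T) ≤ B := by
    rcases hl with rfl | ⟨hl, hlq⟩
    · refine ⟨eLpNorm (fun _ => (1:ℝ)) s (muT T), (memLp_const (1:ℝ)).2.ne, fun β _ => ?_⟩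
      simp
    · refine ⟨ENNReal.ofReal R ^ l, by finiteness, fun β hβ => ?_⟩
      rw [eLpNorm_norm_rpow _ hl, hlq]
      gcongr
  have hfin : ENNReal.ofReal C * B + eLpNorm ω s (muT T) ≠ ⊤ := by
    have := hω.2.ne
    finiteness
  refine ⟨(ENNReal.ofReal C * B + eLpNorm ω s (muT T)).toReal, ENNReal.toReal_nonneg,
    fun β hβm hβ => ?_⟩
  have hpm : AEStronglyMeasurable (fun t => C * ‖β t‖ ^ l) (muT T) := by
    have h1 : AEStronglyMeasurable (fun t => ‖β t‖ ^ l) (muT T) :=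
      (Real.continuous_rpow_const hl0).comp_aestronglyMeasurable hβm.norm
    exact h1.const_mul C
  have hnorm : eLpNorm (fun t => C * ‖β t‖ ^ l + |ω t|) s (muT T)
      ≤ ENNReal.ofReal C * B + eLpNorm ω s (muT T) := by
    refine (eLpNorm_add_le hpm hω.1.norm hs).trans ?_
    refine add_le_add ?_ (le_of_eq (eLpNorm_norm ω))
    have h1 : (fun t => C * ‖β t‖ ^ l) = C • (fun t => ‖β t‖ ^ l) := rfl
    rw [h1, eLpNorm_const_smul, Real.enorm_eq_ofReal hC.le]
    gcongr
    exact hBβ β hβ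
  refine ⟨fun t => C * ‖β t‖ ^ l + |ω t|, ⟨hpm.add hω.1.norm, hnorm.trans_lt hfin.lt_top⟩,
    fun t => by positivity, ENNReal.toReal_mono hfin hnorm, ?_⟩
  filter_upwards [hb] with t ht a b ha hbβ
  refine (ht a b ha).trans ?_
  have h1 : ‖b‖ ≤ ‖β t‖ := hbβ.trans (Real.le_norm_self _)
  gcongr
  exact le_abs_self _


theorem HasMajorants.norm_sub_le_fst {d m : ℕ} {F : Type*} [NormedAddCommGroup F]
    [NormedSpace ℝ F] {T R : ℝ} {h : Vec d → Vec m → ℝ → F}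
    {h' : Vec d → Vec m → ℝ → (Vec d →L[ℝ] F)}
    (hder : ∀ (b : Vec m) (t : ℝ), t ∈ Set.Icc 0 T → ∀ a : Vec d,
      HasFDerivAt (fun a' => h a' b t) (h' a b t) a)
    {G β : ℝ → ℝ} (hG : ∀ᵐ t ∂(muT T), ∀ (a : Vec d) (b : Vec m), ‖a‖ ≤ R → ‖b‖ ≤ β t →
      ‖h' a b t‖ ≤ G t) :
    ∀ᵐ t ∂(muT T), ∀ (a₁ a₂ : Vec d) (b : Vec m), ‖a₁‖ ≤ R → ‖a₂‖ ≤ R → ‖b‖ ≤ β t →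
      ‖h a₁ b t - h a₂ b t‖ ≤ G t * ‖a₁ - a₂‖ := by
  filter_upwards [hG, ae_muT_mem T] with t ht htm a₁ a₂ b h₁ h₂ hb
  refine (convex_closedBall (0 : Vec d) R).norm_image_sub_le_of_norm_hasFDerivWithin_le
    (f := fun a => h a b t) (f' := fun a => h' a b t)
    (fun a _ => (hder b t (Ioc_subset_Icc_self htm) a).hasFDerivWithinAt)
    (fun a ha => ht a b (by simpa using ha) hb) (by simpa using h₂) (by simpa using h₁)

theorem HasMajorants.norm_sub_le_snd {d m : ℕ} {F : Type*} [NormedAddCommGroup F]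
    [NormedSpace ℝ F] {T R : ℝ} {h : Vec d → Vec m → ℝ → F}
    {h' : Vec d → Vec m → ℝ → (Vec m →L[ℝ] F)}
    (hder : ∀ (a : Vec d) (t : ℝ), t ∈ Set.Icc 0 T → ∀ b : Vec m,
      HasFDerivAt (fun b' => h a b' t) (h' a b t) b)
    {G β : ℝ → ℝ} (hG : ∀ᵐ t ∂(muT T), ∀ (a : Vec d) (b : Vec m), ‖a‖ ≤ R → ‖b‖ ≤ β t →
      ‖h' a b t‖ ≤ G t) :
    ∀ᵐ t ∂(muT T), ∀ (a : Vec d) (b₁ b₂ : Vec m), ‖a‖ ≤ R → ‖b₁‖ ≤ β t → ‖b₂‖ ≤ β t →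
      ‖h a b₁ t - h a b₂ t‖ ≤ G t * ‖b₁ - b₂‖ := by
  filter_upwards [hG, ae_muT_mem T] with t ht htm a b₁ b₂ ha h₁ h₂
  refine (convex_closedBall (0 : Vec m) (β t)).norm_image_sub_le_of_norm_hasFDerivWithin_le
    (f := fun b => h a b t) (f' := fun b => h' a b t)
    (fun b _ => (hder a t (Ioc_subset_Icc_self htm) b).hasFDerivWithinAt)
    (fun b hb => ht a b ha (by simpa using hb)) (by simpa using h₂) (by simpa using h₁)

/-- The objective functional is Lipschitz continuous on bounded sets. -/
theorem exists_objFun_lipschitz {d m : ℕ} {T : ℝ} (hT : 0 < T) {q q' : ℝ≥0∞} (hq : 1 ≤ q)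
    (hconj : q⁻¹ + q'⁻¹ = 1)
    {θ : Vec d → Vec m → ℝ → ℝ} {ζ : Vec d → ℝ}
    {θx : Vec d → Vec m → ℝ → (Vec d →L[ℝ] ℝ)} {θu : Vec d → Vec m → ℝ → (Vec m →L[ℝ] ℝ)}
    (hζ : LocallyLipschitz ζ)
    (hθc : ContinuousOn (fun z : Vec d × Vec m × ℝ => θ z.1 z.2.1 z.2.2)
      (Set.univ ×ˢ Set.univ ×ˢ Set.Icc 0 T))
    (hθx : ∀ (b : Vec m) (t : ℝ), t ∈ Set.Icc 0 T → ∀ a : Vec d,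
      HasFDerivAt (fun a' => θ a' b t) (θx a b t) a)
    (hθu : ∀ (a : Vec d) (t : ℝ), t ∈ Set.Icc 0 T → ∀ b : Vec m,
      HasFDerivAt (fun b' => θ a b' t) (θu a b t) b)
    (hMθ : HasMajorants T q 1 θ) (hMx : HasMajorants T q 1 θx) (hMu : HasMajorants T q q' θu)
    (R : ℝ) :
    ∃ M : ℝ, 0 ≤ M ∧ ∀ (x y : ℝ → Vec d) (u v : ℝ → Vec m) (D : ℝ),
      ContinuousOn x (Icc 0 T) → ContinuousOn y (Icc 0 T) →
      MemLp u q (muT T) → MemLp v q (muT T) →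
      (∀ t ∈ Icc 0 T, ‖x t‖ ≤ R) → (∀ t ∈ Icc 0 T, ‖y t‖ ≤ R) →
      (eLpNorm u q (muT T)).toReal ≤ R → (eLpNorm v q (muT T)).toReal ≤ R →
      (∀ t ∈ Icc 0 T, ‖x t - y t‖ ≤ D) →
      |objFun T θ ζ x u - objFun T θ ζ y v|
        ≤ M * (D + (eLpNorm (fun t => u t - v t) q (muT T)).toReal) := by
  set S : ℝ := 2 * |R| + 1 with hS
  have hS0 : 0 < S := by positivity
  have hRS : R ≤ S := by
    have := le_abs_self R
    have := abs_nonneg R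
    linarith
  obtain ⟨M₀, hM₀, h₀⟩ := hMθ S hS0
  obtain ⟨M₁, hM₁, h₁⟩ := hMx S hS0
  obtain ⟨M₂, hM₂, h₂⟩ := hMu S hS0
  obtain ⟨Kζ, hKζ⟩ := (hζ.locallyLipschitzOn (s := Metric.closedBall (0 : Vec d) S)
    ).exists_lipschitzOnWith_of_compact (isCompact_closedBall _ _)
  refine ⟨M₁ + M₂ + Kζ, by positivity, ?_⟩
  intro x y u v D hxc hyc hu hv hx hy huR hvR hD
  have hTmem : T ∈ Icc 0 T := ⟨hT.le, le_rfl⟩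
  have hD0 : 0 ≤ D := (norm_nonneg _).trans (hD T hTmem)
  set β : ℝ → ℝ := fun t => ‖u t‖ + ‖v t‖ with hβ
  have hβm : AEStronglyMeasurable β (muT T) := hu.1.norm.add hv.1.norm
  have hβn : eLpNorm β q (muT T) ≤ ENNReal.ofReal S := by
    have h3 : eLpNorm β q (muT T) ≤ eLpNorm u q (muT T) + eLpNorm v q (muT T) := by
      refine (eLpNorm_add_le hu.1.norm hv.1.norm hq).trans ?_
      rw [eLpNorm_norm, eLpNorm_norm]
    refine h3.trans ?_
    rw [← ENNReal.ofReal_toReal hu.2.ne, ← ENNReal.ofReal_toReal hv.2.ne,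
      ← ENNReal.ofReal_add ENNReal.toReal_nonneg ENNReal.toReal_nonneg]
    refine ENNReal.ofReal_le_ofReal ?_
    have := le_abs_self R
    linarith
  obtain ⟨G₀, hG₀, -, -, hb₀⟩ := h₀ β hβm hβn
  obtain ⟨G₁, hG₁, hG₁p, hG₁M, hb₁⟩ := h₁ β hβm hβn
  obtain ⟨G₂, hG₂, hG₂p, hG₂M, hb₂⟩ := h₂ β hβm hβn
  have hl₁ := HasMajorants.norm_sub_le_fst hθx hb₁
  have hl₂ := HasMajorants.norm_sub_le_snd hθu hb₂
  have hint : ∀ (y : ℝ → Vec d) (v : ℝ → Vec m), ContinuousOn y (Icc 0 T) →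
      AEStronglyMeasurable v (muT T) → (∀ t ∈ Icc 0 T, ‖y t‖ ≤ R) → (∀ t, ‖v t‖ ≤ β t) →
      Integrable (fun t => θ (y t) (v t) t) (muT T) := by
    intro y v hyc hv hy hvβ
    refine (memLp_one_iff_integrable.1 hG₀).mono'
      (aestronglyMeasurable_superposition hT.le hθc hyc hv) ?_
    filter_upwards [hb₀, ae_muT_mem T] with t ht htm
    exact ht _ _ ((hy t (Ioc_subset_Icc_self htm)).trans hRS) (hvβ t)
  have huβ : ∀ t, ‖u t‖ ≤ β t := fun t => le_add_of_nonneg_right (norm_nonneg _)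
  have hvβ : ∀ t, ‖v t‖ ≤ β t := fun t => le_add_of_nonneg_left (norm_nonneg _)
  have hi1 := hint x u hxc hu.1 hx huβ
  have hi2 := hint y v hyc hv.1 hy hvβ
  have hH := integrable_mul_and_integral_mul_le (by rwa [add_comm] at hconj) hG₂ (hu.sub hv).norm
  have hG₁i : Integrable (fun t => G₁ t * D) (muT T) :=
    (memLp_one_iff_integrable.1 hG₁).mul_const D
  have hmain : |(∫ t, θ (x t) (u t) t ∂(muT T)) - ∫ t, θ (y t) (v t) t ∂(muT T)|
      ≤ M₁ * D + M₂ * (eLpNorm (fun t => u t - v t) q (muT T)).toReal := by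
    rw [← integral_sub hi1 hi2, ← Real.norm_eq_abs]
    calc _ ≤ ∫ t, (G₁ t * D + G₂ t * ‖(u - v) t‖) ∂(muT T) := by
          refine norm_integral_le_of_norm_le (hG₁i.add hH.1) ?_
          filter_upwards [hl₁, hl₂, ae_muT_mem T] with t h3 h4 htm
          have htm' := Ioc_subset_Icc_self htm
          have h5 := h3 (x t) (y t) (u t) ((hx t htm').trans hRS) ((hy t htm').trans hRS) (huβ t)
          have h6 := h4 (y t) (u t) (v t) ((hy t htm').trans hRS) (huβ t) (hvβ t)
          have h7 : θ (x t) (u t) t - θ (y t) (v t) t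
              = (θ (x t) (u t) t - θ (y t) (u t) t) + (θ (y t) (u t) t - θ (y t) (v t) t) := by
            ring
          rw [h7]
          refine (norm_add_le _ _).trans (add_le_add (h5.trans ?_) h6)
          exact mul_le_mul_of_nonneg_left (hD t htm') (hG₁p t)
      _ = (∫ t, G₁ t ∂(muT T)) * D + ∫ t, G₂ t * ‖(u - v) t‖ ∂(muT T) := by
          rw [integral_add hG₁i hH.1, integral_mul_const]
      _ ≤ _ := by
          refine add_le_add (mul_le_mul_of_nonneg_right ?_ hD0) (hH.2.trans ?_)
          · refine le_trans (le_of_eq ?_) hG₁M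
            rw [eLpNorm_one_eq_lintegral_enorm, ← integral_norm_eq_lintegral_enorm hG₁.1]
            simp_rw [Real.norm_of_nonneg (hG₁p _)]
          · rw [eLpNorm_norm]
            exact mul_le_mul_of_nonneg_right hG₂M ENNReal.toReal_nonneg
  have hend : |ζ (x T) - ζ (y T)| ≤ Kζ * D := by
    have h3 := hKζ.norm_sub_le (x := x T) (y := y T) (by simpa using (hx T hTmem).trans hRS)
      (by simpa using (hy T hTmem).trans hRS)
    rw [Real.norm_eq_abs] at h3
    exact h3.trans (mul_le_mul_of_nonneg_left (hD T hTmem) Kζ.2)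
  have hsplit : objFun T θ ζ x u - objFun T θ ζ y v
      = ((∫ t, θ (x t) (u t) t ∂(muT T)) - ∫ t, θ (y t) (v t) t ∂(muT T))
        + (ζ (x T) - ζ (y T)) := by
    simp only [objFun, muT]
    ring
  rw [hsplit]
  refine (abs_add_le _ _).trans ((add_le_add hmain hend).trans ?_)
  have h8 : 0 ≤ (eLpNorm (fun t => u t - v t) q (muT T)).toReal := ENNReal.toReal_nonneg
  have h9 : 0 ≤ (Kζ : ℝ) := Kζ.2
  nlinarith [mul_nonneg hM₁ h8, mul_nonneg hM₂ hD0, mul_nonneg h9 h8]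


theorem InW.continuousOn {d : ℕ} {T p : ℝ} (hT : 0 ≤ T) {x x' : ℝ → Vec d} (h : InW T p x x') :
    ContinuousOn x (Icc 0 T) := by
  have h1 := intervalIntegral.continuousOn_primitive_interval' h.1 left_mem_uIcc
  rw [uIcc_of_le hT] at h1
  exact (continuousOn_const.add h1).congr h.2.1

theorem norm_intervalIntegral_le_integral_muT {E : Type*} [NormedAddCommGroup E]
    [NormedSpace ℝ E] {T t : ℝ} (ht : t ∈ Icc 0 T) {h : ℝ → E} (hh : Integrable h (muT T)) :
    ‖∫ s in (0:ℝ)..t, h s‖ ≤ ∫ s, ‖h s‖ ∂(muT T) := by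
  rw [intervalIntegral.integral_of_le ht.1]
  refine (norm_integral_le_integral_norm _).trans ?_
  exact integral_mono_measure (muT_mono ht.2) (Eventually.of_forall fun _ => norm_nonneg _) hh.norm

theorem memLp_superposition {d m : ℕ} {F : Type*} [NormedAddCommGroup F] {T R : ℝ} (hT : 0 ≤ T)
    {s : ℝ≥0∞} {h : Vec d → Vec m → ℝ → F}
    (hc : ContinuousOn (fun z : Vec d × Vec m × ℝ => h z.1 z.2.1 z.2.2)
      (Set.univ ×ˢ Set.univ ×ˢ Set.Icc 0 T))
    {x : ℝ → Vec d} {u : ℝ → Vec m} (hx : ContinuousOn x (Icc 0 T))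
    (hxR : ∀ t ∈ Icc 0 T, ‖x t‖ ≤ R) (hu : AEStronglyMeasurable u (muT T)) {G : ℝ → ℝ}
    (hG : MemLp G s (muT T))
    (hb : ∀ᵐ t ∂(muT T), ∀ (a : Vec d) (b : Vec m), ‖a‖ ≤ R → ‖b‖ ≤ ‖u t‖ → ‖h a b t‖ ≤ G t) :
    MemLp (fun t => h (x t) (u t) t) s (muT T) := by
  refine hG.mono' (aestronglyMeasurable_superposition hT hc hx hu) ?_
  filter_upwards [hb, ae_muT_mem T] with t ht htm
  exact ht _ _ (hxR t (Ioc_subset_Icc_self htm)) le_rfl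

theorem HasMajorants.memLp {d m : ℕ} {F : Type*} [NormedAddCommGroup F] {T : ℝ} (hT : 0 ≤ T)
    {q s : ℝ≥0∞} {h : Vec d → Vec m → ℝ → F} (hM : HasMajorants T q s h)
    (hc : ContinuousOn (fun z : Vec d × Vec m × ℝ => h z.1 z.2.1 z.2.2)
      (Set.univ ×ˢ Set.univ ×ˢ Set.Icc 0 T))
    {x : ℝ → Vec d} {u : ℝ → Vec m} (hx : ContinuousOn x (Icc 0 T)) (hu : MemLp u q (muT T)) :
    MemLp (fun t => h (x t) (u t) t) s (muT T) := by
  obtain ⟨R, hR⟩ := isCompact_Icc.exists_bound_of_continuousOn hx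
  set S := |R| + (eLpNorm u q (muT T)).toReal + 1 with hS
  have hu0 : 0 ≤ (eLpNorm u q (muT T)).toReal := ENNReal.toReal_nonneg
  have hS0 : 0 < S := by positivity
  obtain ⟨M, -, h1⟩ := hM S hS0
  obtain ⟨G, hG, -, -, hb⟩ := h1 (fun t => ‖u t‖) hu.1.norm (by
    rw [eLpNorm_norm, ← ENNReal.ofReal_toReal hu.2.ne]
    refine ENNReal.ofReal_le_ofReal ?_
    have := abs_nonneg R
    linarith)
  refine memLp_superposition hT hc hx (fun t ht => (hR t ht).trans ?_) hu.1 hG hb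
  have := le_abs_self R
  linarith

/-- For a trajectory with small defect one can reduce the defect `ẋ - f(x,u,t)` by the factor
`1 - s`, moving the trajectory by at most a constant times `s` times the size of the defect and
keeping the control. -/
theorem exists_partial_correction {d m : ℕ} {T p : ℝ} (hT : 0 < T) (hp : 1 < p) {q : ℝ≥0∞}
    {f : Vec d → Vec m → ℝ → Vec d} {fx : Vec d → Vec m → ℝ → (Vec d →L[ℝ] Vec d)}
    (hfc : ContinuousOn (fun z : Vec d × Vec m × ℝ => f z.1 z.2.1 z.2.2)
      (Set.univ ×ˢ Set.univ ×ˢ Set.Icc 0 T))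
    (hfx : ∀ (b : Vec m) (t : ℝ), t ∈ Set.Icc 0 T → ∀ a : Vec d,
      HasFDerivAt (fun a' => f a' b t) (fx a b t) a)
    (hMf : HasMajorants T q (ENNReal.ofReal p) f) (hMfx : HasMajorants T q (ENNReal.ofReal p) fx)
    (R : ℝ) :
    ∃ K : ℝ, 0 < K ∧ ∃ ρ : ℝ, 0 < ρ ∧ ∀ (x x' : ℝ → Vec d) (u : ℝ → Vec m), InW T p x x' →
      MemLp u q (muT T) → (∀ t ∈ Icc 0 T, ‖x t‖ ≤ R) → (eLpNorm u q (muT T)).toReal ≤ R →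
      (penTerm T p f x x' u).toReal < ρ → ∀ s : ℝ, 0 ≤ s → s ≤ 1 →
      ∃ y y' : ℝ → Vec d, InW T p y y' ∧ y 0 = x 0 ∧ (∀ t ∈ Icc 0 T, ‖y t‖ ≤ R + 1) ∧
        (penTerm T p f y y' u).toReal = (1 - s) * (penTerm T p f x x' u).toReal ∧
        (∀ t ∈ Icc 0 T, ‖y t - x t‖ ≤ K * (s * (penTerm T p f x x' u).toReal)) ∧
        (eLpNorm (fun t => y' t - x' t) (ENNReal.ofReal p) (muT T)).toReal
          ≤ K * (s * (penTerm T p f x x' u).toReal) := by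
  have hp1 : (1 : ℝ≥0∞) ≤ ENNReal.ofReal p := by
    rw [← ENNReal.ofReal_one]
    exact ENNReal.ofReal_le_ofReal hp.le
  set S := |R| + 1 with hS
  have hS0 : 0 < S := by positivity
  have hRS : R + 1 ≤ S := by
    have := le_abs_self R
    linarith
  obtain ⟨M₀, -, h₀⟩ := hMf S hS0
  obtain ⟨M, hM, h₁⟩ := hMfx S hS0
  obtain ⟨k, hk, hweight⟩ := exists_exp_weight (T := T) hp hM
  obtain ⟨κ, hκ, hκint⟩ := exists_integral_norm_le (T := T) hp
  set W := 2 * κ * Real.exp (k * T) with hW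
  have hW0 : 0 < W := by positivity
  refine ⟨W + M * W + 1, by positivity, 1 / W, by positivity, ?_⟩
  intro x x' u hxW hu hxR huR hφ s hs0 hs1
  have hxc := hxW.continuousOn hT.le
  set φ := (penTerm T p f x x' u).toReal with hφdef
  have hφ0 : 0 ≤ φ := ENNReal.toReal_nonneg
  have hβ : eLpNorm (fun t => ‖u t‖) q (muT T) ≤ ENNReal.ofReal S := by
    rw [eLpNorm_norm, ← ENNReal.ofReal_toReal hu.2.ne]
    exact ENNReal.ofReal_le_ofReal (by linarith)
  obtain ⟨G₀, hG₀, -, -, hb₀⟩ := h₀ _ hu.1.norm hβ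
  obtain ⟨G, hG, hGp, hGM, hb⟩ := h₁ _ hu.1.norm hβ
  have hlip := HasMajorants.norm_sub_le_fst hfx hb
  have hfmem : ∀ y : ℝ → Vec d, ContinuousOn y (Icc 0 T) → (∀ t ∈ Icc 0 T, ‖y t‖ ≤ S) →
      MemLp (fun t => f (y t) (u t) t) (ENNReal.ofReal p) (muT T) :=
    fun y hy hyS => memLp_superposition hT.le hfc hy hyS hu.1 hG₀ hb₀
  set r : ℝ → Vec d := fun t => x' t - f (x t) (u t) t with hr
  have hrmem : MemLp r (ENNReal.ofReal p) (muT T) :=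
    hxW.2.2.sub (hfmem x hxc fun t ht => (hxR t ht).trans (by linarith))
  have hrφ : (eLpNorm r (ENNReal.ofReal p) (muT T)).toReal = φ := rfl
  have hrint : ∫ t, ‖r t‖ ∂(muT T) ≤ κ * φ := hκint r hrmem
  set g : ℝ → Vec d → Vec d := fun t a => f a (u t) t + (1 - s) • r t with hg
  have htubeS : ∀ y : ℝ → Vec d, (∀ t ∈ Icc 0 T, ‖y t - x t‖ ≤ 1) →
      ∀ t ∈ Icc 0 T, ‖y t‖ ≤ R + 1 := by
    intro y hy t ht
    have h2 : y t = x t + (y t - x t) := by abel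
    rw [h2]
    exact (norm_add_le _ _).trans (add_le_add (hxR t ht) (hy t ht))
  have hgmem : ∀ y : ℝ → Vec d, ContinuousOn y (Icc 0 T) → (∀ t ∈ Icc 0 T, ‖y t - x t‖ ≤ 1) →
      MemLp (fun t => g t (y t)) (ENNReal.ofReal p) (muT T) := fun y hy hyx =>
    (hfmem y hy fun t ht => (htubeS y hyx t ht).trans hRS).add (hrmem.const_smul (1 - s))
  have hgint : ∀ y : ℝ → Vec d, ContinuousOn y (Icc 0 T) → (∀ t ∈ Icc 0 T, ‖y t - x t‖ ≤ 1) →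
      IntervalIntegrable (fun t => g t (y t)) volume 0 T := fun y hy hyx =>
    (integrable_muT_iff hT.le).1 ((hgmem y hy hyx).integrable hp1)
  have hxx : ∀ t ∈ Icc 0 T, ‖x t - x t‖ ≤ 1 := by simp
  have hWφ : W * φ ≤ 1 := by
    have := (lt_div_iff₀ hW0).1 hφ
    linarith
  have hWφs : W * (s * φ) ≤ 1 := by
    have : W * (s * φ) = s * (W * φ) := by ring
    rw [this]
    have : 0 ≤ W * φ := by positivity
    nlinarith
  obtain ⟨y, hyc, hyint, hyx⟩ := exists_integral_equation_near (g := g) (x := x) (x₀ := x 0)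
    (L := G) (k := k) (ε := κ * (s * φ)) hT.le hk.le (by positivity) hxc hgint
    ((integrable_muT_iff hT.le).1 (by
      have h2 := (hG.integrable hp1).mul_bdd (c := Real.exp (k * T))
        (f := G) (g := fun s => Real.exp (k * s)) (by fun_prop) (by
          filter_upwards [ae_muT_mem T] with t ht
          rw [Real.norm_eq_abs, Real.abs_exp, Real.exp_le_exp]
          exact mul_le_mul_of_nonneg_left ht.2 hk.le)
      exact h2))
    (Eventually.of_forall fun t _ => hGp t)
    (by
      refine ae_muT_iff.1 ?_
      filter_upwards [hlip, ae_muT_mem T] with t ht htm a b ha hb'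
      have htm' := Ioc_subset_Icc_self htm
      have hbd : ∀ a : Vec d, ‖a - x t‖ ≤ 1 → ‖a‖ ≤ S := by
        intro a ha
        have h2 : a = x t + (a - x t) := by abel
        rw [h2]
        exact (norm_add_le _ _).trans ((add_le_add (hxR t htm') ha).trans hRS)
      simp only [hg, add_sub_add_right_eq_sub]
      exact ht a b (u t) (hbd a ha) (hbd b hb') le_rfl)
    (hweight G hG hGM)
    (by
      intro t ht
      have hsub : ∀ h : ℝ → Vec d, IntervalIntegrable h volume 0 T →
          IntervalIntegrable h volume 0 t := by
        intro h hh
        refine hh.mono_set ?_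
        rw [uIcc_of_le ht.1, uIcc_of_le hT.le]
        exact Icc_subset_Icc_right ht.2
      have h2 : x 0 + (∫ σ in (0:ℝ)..t, g σ (x σ)) - x t = ∫ σ in (0:ℝ)..t, (-s) • r σ := by
        rw [hxW.2.1 t ht, add_sub_add_left_eq_sub,
          ← intervalIntegral.integral_sub (hsub _ (hgint x hxc hxx)) (hsub _ hxW.1)]
        congr 1
        ext1 σ
        simp only [hg, hr]
        module
      rw [h2, intervalIntegral.integral_smul, norm_smul, norm_neg, Real.norm_of_nonneg hs0]
      have h3 := norm_intervalIntegral_le_integral_muT ht (hrmem.integrable hp1)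
      have h4 := mul_le_mul_of_nonneg_left (h3.trans hrint) hs0
      linarith)
    (by
      have : 2 * (κ * (s * φ)) * Real.exp (k * T) = W * (s * φ) := by
        rw [hW]
        ring
      linarith)
  have hyx' : ∀ t ∈ Icc 0 T, ‖y t - x t‖ ≤ W * (s * φ) := by
    intro t ht
    refine (hyx t ht).trans ?_
    have h2 : k * t ≤ k * T := mul_le_mul_of_nonneg_left ht.2 hk.le
    calc 2 * (κ * (s * φ)) * Real.exp (k * t) ≤ 2 * (κ * (s * φ)) * Real.exp (k * T) := by gcongr
      _ = _ := by
        rw [hW]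
        ring
  have hy1 : ∀ t ∈ Icc 0 T, ‖y t - x t‖ ≤ 1 := fun t ht => (hyx' t ht).trans hWφs
  have hy0 : y 0 = x 0 := by simpa using hyint 0 ⟨le_rfl, hT.le⟩
  have hsφ : 0 ≤ s * φ := by positivity
  refine ⟨y, fun t => g t (y t), ⟨hgint y hyc hy1, ?_, hgmem y hyc hy1⟩, hy0, htubeS y hy1,
    ?_, ?_, ?_⟩
  · intro t ht
    rw [hy0]
    exact hyint t ht
  · have h2 : (fun t => g t (y t) - f (y t) (u t) t) = (1 - s) • r := by
      ext1 t
      simp [hg]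
    rw [penTerm, h2, eLpNorm_const_smul, ENNReal.toReal_mul, hrφ,
      Real.enorm_eq_ofReal (by linarith), ENNReal.toReal_ofReal (by linarith)]
  · intro t ht
    refine (hyx' t ht).trans ?_
    refine mul_le_mul_of_nonneg_right ?_ hsφ
    have : 0 ≤ M * W := by positivity
    linarith
  · have hbound : eLpNorm (fun t => g t (y t) - x' t) (ENNReal.ofReal p) (muT T)
        ≤ eLpNorm ((W * (s * φ)) • G) (ENNReal.ofReal p) (muT T)
          + eLpNorm (s • r) (ENNReal.ofReal p) (muT T) := by
      refine le_trans ?_ (eLpNorm_add_le (hG.1.norm.const_smul (W * (s * φ)))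
        (hrmem.1.norm.const_smul s) hp1) |>.trans (le_of_eq ?_)
      · refine eLpNorm_mono_ae_real ?_
        filter_upwards [hlip, ae_muT_mem T] with t ht htm
        have htm' := Ioc_subset_Icc_self htm
        have h2 : g t (y t) - x' t = (f (y t) (u t) t - f (x t) (u t) t) + (-s) • r t := by
          simp only [hg, hr]
          module
        rw [h2]
        refine (norm_add_le _ _).trans (add_le_add ?_ ?_)
        · refine (ht _ _ _ ((htubeS y hy1 t htm').trans hRS) ((htubeS x hxx t htm').trans hRS)
            le_rfl).trans ?_
          rw [Pi.smul_apply, smul_eq_mul, mul_comm, Real.norm_of_nonneg (hGp t)]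
          exact mul_le_mul_of_nonneg_right (hyx' t htm') (hGp t)
        · rw [norm_smul, norm_neg, Real.norm_of_nonneg hs0]
          rfl
      · rw [eLpNorm_const_smul, eLpNorm_const_smul, eLpNorm_const_smul, eLpNorm_const_smul,
          eLpNorm_norm, eLpNorm_norm]
    have hfin : eLpNorm ((W * (s * φ)) • G) (ENNReal.ofReal p) (muT T)
          + eLpNorm (s • r) (ENNReal.ofReal p) (muT T) ≠ ⊤ :=
      ENNReal.add_ne_top.2 ⟨(hG.const_smul _).2.ne, (hrmem.const_smul s).2.ne⟩
    refine (ENNReal.toReal_mono hfin hbound).trans ?_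
    rw [ENNReal.toReal_add (hG.const_smul _).2.ne (hrmem.const_smul s).2.ne, eLpNorm_const_smul,
      eLpNorm_const_smul, ENNReal.toReal_mul, ENNReal.toReal_mul, hrφ,
      Real.enorm_eq_ofReal (by positivity), Real.enorm_eq_ofReal hs0,
      ENNReal.toReal_ofReal (by positivity), ENNReal.toReal_ofReal hs0]
    have h3 : W * (s * φ) * (eLpNorm G (ENNReal.ofReal p) (muT T)).toReal ≤ W * (s * φ) * M :=
      mul_le_mul_of_nonneg_left hGM (by positivity)
    have h4 : 0 ≤ W * (s * φ) := by positivity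
    linarith


theorem mul_ofReal_toReal_sub_one {q q' : ℝ≥0∞} (hq : 1 < q) (hqt : q ≠ ⊤)
    (hconj : q⁻¹ + q'⁻¹ = 1) : q' * ENNReal.ofReal (q.toReal - 1) = q := by
  have hq0 : q ≠ 0 := (zero_lt_one.trans hq).ne'
  have hq't : q' ≠ ⊤ := by
    rintro rfl
    rw [ENNReal.inv_top, add_zero, ENNReal.inv_eq_one] at hconj
    exact hq.ne' hconj
  have hq'0 : q' ≠ 0 := by
    rintro rfl
    simp at hconj
  have ha : 1 < q.toReal := by
    rw [← ENNReal.toReal_one]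
    exact (ENNReal.toReal_lt_toReal ENNReal.one_ne_top hqt).2 hq
  have hb : 0 < q'.toReal := ENNReal.toReal_pos hq'0 hq't
  have h1 : q.toReal⁻¹ + q'.toReal⁻¹ = 1 := by
    have := congrArg ENNReal.toReal hconj
    rwa [ENNReal.toReal_add (ENNReal.inv_ne_top.2 hq0) (ENNReal.inv_ne_top.2 hq'0),
      ENNReal.toReal_inv, ENNReal.toReal_inv, ENNReal.toReal_one] at this
  have ha0 : 0 < q.toReal := by linarith
  have h2 : q'.toReal * (q.toReal - 1) = q.toReal := by
    field_simp at h1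
    linarith
  conv_lhs => rw [← ENNReal.ofReal_toReal hq't]
  rw [← ENNReal.ofReal_mul hb.le, h2, ENNReal.ofReal_toReal hqt]

theorem HasMajorants.of_norm_eq {d m : ℕ} {F F' : Type*} [NormedAddCommGroup F]
    [NormedAddCommGroup F'] {T : ℝ} {q s : ℝ≥0∞} {h : Vec d → Vec m → ℝ → F}
    {h' : Vec d → Vec m → ℝ → F'} (hM : HasMajorants T q s h)
    (heq : ∀ a b t, ‖h' a b t‖ = ‖h a b t‖) : HasMajorants T q s h' := by
  simpa only [HasMajorants, heq] using hM

theorem distC_triangle {d m : ℕ} {T p : ℝ} (hT : 0 ≤ T) (hp : 1 < p) {q : ℝ≥0∞} (hq : 1 ≤ q)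
    {U : Set (ℝ → Vec m)} {x₀ : Vec d} {x y z : Traj d m} (hx : x ∈ AsetC T p q U x₀)
    (hy : y ∈ AsetC T p q U x₀) (hz : z ∈ AsetC T p q U x₀) :
    distC T p q x z ≤ distC T p q x y + distC T p q y z := by
  have hp1 : (1 : ℝ≥0∞) ≤ ENNReal.ofReal p := by
    rw [← ENNReal.ofReal_one]
    exact ENNReal.ofReal_le_ofReal hp.le
  have key : ∀ {E : Type} [NormedAddCommGroup E] {s : ℝ≥0∞} (_ : 1 ≤ s) {a b c : ℝ → E},
      MemLp a s (muT T) → MemLp b s (muT T) → MemLp c s (muT T) →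
      (eLpNorm (fun t => a t - c t) s (muT T)).toReal
        ≤ (eLpNorm (fun t => a t - b t) s (muT T)).toReal
          + (eLpNorm (fun t => b t - c t) s (muT T)).toReal := by
    intro E _ s hs a b c ha hb hc
    have h1 : (fun t => a t - c t) = (fun t => a t - b t) + (fun t => b t - c t) := by
      ext1 t
      simp
    have hab : MemLp (fun t => a t - b t) s (muT T) := ha.sub hb
    have hbc : MemLp (fun t => b t - c t) s (muT T) := hb.sub hc
    rw [h1, ← ENNReal.toReal_add hab.2.ne hbc.2.ne]
    exact ENNReal.toReal_mono (ENNReal.add_ne_top.2 ⟨hab.2.ne, hbc.2.ne⟩)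
      (eLpNorm_add_le hab.1 hbc.1 hs)
  have hmem : ∀ w ∈ AsetC T p q U x₀, MemLp w.1 (ENNReal.ofReal p) (muT T) := by
    intro w hw
    have hc := hw.1.continuousOn hT
    obtain ⟨C, hC⟩ := isCompact_Icc.exists_bound_of_continuousOn hc
    refine MemLp.of_bound ((hc.mono Ioc_subset_Icc_self).aestronglyMeasurable measurableSet_Ioc)
      C ?_
    filter_upwards [ae_muT_mem T] with t ht
    exact hC t (Ioc_subset_Icc_self ht)
  have h1 := key hp1 (hmem x hx) (hmem y hy) (hmem z hz)
  have h2 := key hp1 hx.1.2.2 hy.1.2.2 hz.1.2.2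
  have h3 := key hq hx.2.1 hy.2.1 hz.2.1
  unfold distC
  linarith

theorem penTerm_eq_of_distC_eq_zero {d m : ℕ} {T p : ℝ} (hT : 0 ≤ T) (hp : 1 < p) {q : ℝ≥0∞}
    (hq : 1 ≤ q) {U : Set (ℝ → Vec m)} {x₀ : Vec d} {f : Vec d → Vec m → ℝ → Vec d}
    {w z : Traj d m} (hw : w ∈ AsetC T p q U x₀) (hz : z ∈ AsetC T p q U x₀)
    (h : distC T p q w z = 0) :
    penTerm T p f w.1 w.2.1 w.2.2 = penTerm T p f z.1 z.2.1 z.2.2 := by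
  have hp0 : ENNReal.ofReal p ≠ 0 := by
    simp only [ne_eq, ENNReal.ofReal_eq_zero, not_le]
    linarith
  have hq0 : q ≠ 0 := (zero_lt_one.trans_le hq).ne'
  have key : ∀ {E : Type} [NormedAddCommGroup E] {s : ℝ≥0∞} (_ : s ≠ 0) {a b : ℝ → E},
      MemLp (fun t => a t - b t) s (muT T) →
      (eLpNorm (fun t => a t - b t) s (muT T)).toReal = 0 → ∀ᵐ t ∂(muT T), a t = b t := by
    intro E _ s hs a b hab h0
    rw [ENNReal.toReal_eq_zero_iff, or_iff_left hab.2.ne, eLpNorm_eq_zero_iff hab.1 hs] at h0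
    filter_upwards [h0] with t ht
    exact sub_eq_zero.1 ht
  have hc : ContinuousOn (fun t => w.1 t - z.1 t) (Icc 0 T) :=
    (hw.1.continuousOn hT).sub (hz.1.continuousOn hT)
  obtain ⟨C, hC⟩ := isCompact_Icc.exists_bound_of_continuousOn hc
  have hx : MemLp (fun t => w.1 t - z.1 t) (ENNReal.ofReal p) (muT T) := by
    refine MemLp.of_bound ((hc.mono Ioc_subset_Icc_self).aestronglyMeasurable measurableSet_Ioc)
      C ?_
    filter_upwards [ae_muT_mem T] with t ht
    exact hC t (Ioc_subset_Icc_self ht)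
  unfold distC at h
  have n1 : 0 ≤ (eLpNorm (fun t => w.1 t - z.1 t) (ENNReal.ofReal p) (muT T)).toReal :=
    ENNReal.toReal_nonneg
  have n2 : 0 ≤ (eLpNorm (fun t => w.2.1 t - z.2.1 t) (ENNReal.ofReal p) (muT T)).toReal :=
    ENNReal.toReal_nonneg
  have n3 : 0 ≤ (eLpNorm (fun t => w.2.2 t - z.2.2 t) q (muT T)).toReal :=
    ENNReal.toReal_nonneg
  have e1 := key hp0 hx (by linarith)
  have e2 := key hp0 (hw.1.2.2.sub hz.1.2.2) (by linarith)
  have e3 := key hq0 (hw.2.1.sub hz.2.1) (by linarith)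
  refine eLpNorm_congr_ae ?_
  filter_upwards [e1, e2, e3] with t h1 h2 h3
  rw [h1, h2, h3]

theorem norm_sub_le_of_memA {d m : ℕ} {T p : ℝ} {q : ℝ≥0∞} {U : Set (ℝ → Vec m)} {x₀ : Vec d}
    (hp : 1 < p) {κ : ℝ} (hκ : ∀ {E : Type} [NormedAddCommGroup E] (h : ℝ → E),
      MemLp h (ENNReal.ofReal p) (muT T) →
      ∫ t, ‖h t‖ ∂(muT T) ≤ κ * (eLpNorm h (ENNReal.ofReal p) (muT T)).toReal)
    {w z : Traj d m} (hw : w ∈ AsetC T p q U x₀) (hz : z ∈ AsetC T p q U x₀) :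
    ∀ t ∈ Icc 0 T, ‖w.1 t - z.1 t‖ ≤
      κ * (eLpNorm (fun t => w.2.1 t - z.2.1 t) (ENNReal.ofReal p) (muT T)).toReal := by
  intro t ht
  have hp1 : (1 : ℝ≥0∞) ≤ ENNReal.ofReal p := by
    rw [← ENNReal.ofReal_one]
    exact ENNReal.ofReal_le_ofReal hp.le
  have hT : 0 ≤ T := ht.1.trans ht.2
  have hsub : ∀ h : ℝ → Vec d, IntervalIntegrable h volume 0 T →
      IntervalIntegrable h volume 0 t := by
    intro h hh
    refine hh.mono_set ?_
    rw [uIcc_of_le ht.1, uIcc_of_le hT]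
    exact Icc_subset_Icc_right ht.2
  have hmem : MemLp (fun t => w.2.1 t - z.2.1 t) (ENNReal.ofReal p) (muT T) :=
    hw.1.2.2.sub hz.1.2.2
  rw [hw.1.2.1 t ht, hz.1.2.1 t ht, hw.2.2.2, hz.2.2.2, add_sub_add_left_eq_sub,
    ← intervalIntegral.integral_sub (hsub _ hw.1.1) (hsub _ hz.1.1)]
  exact (norm_intervalIntegral_le_integral_muT ht (hmem.integrable hp1)).trans (hκ _ hmem)

theorem norm_le_of_memA {d m : ℕ} {T p : ℝ} {q : ℝ≥0∞} {U : Set (ℝ → Vec m)} {x₀ : Vec d}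
    (hp : 1 < p) {κ : ℝ} (hκ : ∀ {E : Type} [NormedAddCommGroup E] (h : ℝ → E),
      MemLp h (ENNReal.ofReal p) (muT T) →
      ∫ t, ‖h t‖ ∂(muT T) ≤ κ * (eLpNorm h (ENNReal.ofReal p) (muT T)).toReal)
    {z : Traj d m} (hz : z ∈ AsetC T p q U x₀) :
    ∀ t ∈ Icc 0 T, ‖z.1 t‖ ≤
      ‖x₀‖ + κ * (eLpNorm z.2.1 (ENNReal.ofReal p) (muT T)).toReal := by
  intro t ht
  have hp1 : (1 : ℝ≥0∞) ≤ ENNReal.ofReal p := by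
    rw [← ENNReal.ofReal_one]
    exact ENNReal.ofReal_le_ofReal hp.le
  rw [hz.1.2.1 t ht, hz.2.2.2]
  refine (norm_add_le _ _).trans (add_le_add le_rfl ?_)
  exact (norm_intervalIntegral_le_integral_muT ht (hz.1.2.2.integrable hp1)).trans
    (hκ _ hz.1.2.2)

/-- Theorem 3.1: under assumptions (1)–(4), there exists `λ* ≥ 0` such that for every `λ ≥ λ*`
the penalty function `Φ_λ` for the free-endpoint optimal control problem is completely exact on
`S_λ(c)`: the optimal values and globally optimal solutions of the penalised and original problems
coincide, and a point of `S_λ(c)` is a local minimiser (resp. inf-stationary point) of `Φ_λ` on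
`A` iff it is a locally optimal solution of the problem (resp. belongs to `Ω` and is an
inf-stationary point of `I` on `Ω`). -/
theorem free_endpoint_penalty_completely_exact {d m : ℕ} (T : ℝ) (hT : 0 < T) (x₀ : Vec d)
    (p : ℝ) (hp : 1 < p) (q q' : ℝ≥0∞) (hq : 1 ≤ q) (hconj : q⁻¹ + q'⁻¹ = 1)
    (θ : Vec d → Vec m → ℝ → ℝ) (f : Vec d → Vec m → ℝ → Vec d) (ζ : Vec d → ℝ)
    (θx : Vec d → Vec m → ℝ → Vec d) (θu : Vec d → Vec m → ℝ → Vec m)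
    (fx : Vec d → Vec m → ℝ → (Vec d →L[ℝ] Vec d))
    (U : Set (ℝ → Vec m)) (hUsub : ∀ u ∈ U, MemLp u q (muT T))
    -- `U` is (sequentially) closed in `L^q_m(0,T)`
    (hUclosed : ∀ u : ℝ → Vec m, MemLp u q (muT T) →
      (∀ ε : ℝ, 0 < ε →
        ∃ v ∈ U, eLpNorm (fun t => u t - v t) q (muT T) < ENNReal.ofReal ε) → u ∈ U)
    -- assumption 1: smoothness
    (hζ : LocallyLipschitz ζ)
    (hθc : ContinuousOn (fun z : Vec d × Vec m × ℝ => θ z.1 z.2.1 z.2.2)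
      (Set.univ ×ˢ Set.univ ×ˢ Set.Icc 0 T))
    (hθx : ∀ (b : Vec m) (t : ℝ), t ∈ Set.Icc 0 T → ∀ a : Vec d,
      HasGradientAt (fun a' => θ a' b t) (θx a b t) a)
    (hθu : ∀ (a : Vec d) (t : ℝ), t ∈ Set.Icc 0 T → ∀ b : Vec m,
      HasGradientAt (fun b' => θ a b' t) (θu a b t) b)
    (hθxc : ContinuousOn (fun z : Vec d × Vec m × ℝ => θx z.1 z.2.1 z.2.2)
      (Set.univ ×ˢ Set.univ ×ˢ Set.Icc 0 T))
    (hθuc : ContinuousOn (fun z : Vec d × Vec m × ℝ => θu z.1 z.2.1 z.2.2)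
      (Set.univ ×ˢ Set.univ ×ˢ Set.Icc 0 T))
    (hfc : ContinuousOn (fun z : Vec d × Vec m × ℝ => f z.1 z.2.1 z.2.2)
      (Set.univ ×ˢ Set.univ ×ˢ Set.Icc 0 T))
    (hfx : ∀ (b : Vec m) (t : ℝ), t ∈ Set.Icc 0 T → ∀ a : Vec d,
      HasFDerivAt (fun a' => f a' b t) (fx a b t) a)
    (hfxc : ContinuousOn (fun z : Vec d × Vec m × ℝ => fx z.1 z.2.1 z.2.2)
      (Set.univ ×ˢ Set.univ ×ˢ Set.Icc 0 T))
    -- assumption 2: either `q = ∞` or the growth conditions hold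
    (hgrowth : q = ⊤ ∨
      ((∀ R : ℝ, 0 < R → ∃ C : ℝ, 0 < C ∧ ∃ ω : ℝ → ℝ,
          Integrable ω (muT T) ∧ (∀ᵐ t ∂(muT T), 0 ≤ ω t) ∧
          ∀ᵐ t ∂(muT T), ∀ (a : Vec d) (b : Vec m), ‖a‖ ≤ R →
            |θ a b t| ≤ C * ‖b‖ ^ q.toReal + ω t) ∧
        (∀ R : ℝ, 0 < R → ∃ C : ℝ, 0 < C ∧ ∃ ω : ℝ → ℝ,
          Integrable ω (muT T) ∧ (∀ᵐ t ∂(muT T), 0 ≤ ω t) ∧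
          ∀ᵐ t ∂(muT T), ∀ (a : Vec d) (b : Vec m), ‖a‖ ≤ R →
            ‖θx a b t‖ ≤ C * ‖b‖ ^ q.toReal + ω t) ∧
        (∀ R : ℝ, 0 < R → ∃ C : ℝ, 0 < C ∧ ∃ η : ℝ → ℝ,
          MemLp η q' (muT T) ∧ (∀ᵐ t ∂(muT T), 0 ≤ η t) ∧
          ∀ᵐ t ∂(muT T), ∀ (a : Vec d) (b : Vec m), ‖a‖ ≤ R →
            ‖θu a b t‖ ≤ C * ‖b‖ ^ (q.toReal - 1) + η t) ∧
        (∀ R : ℝ, 0 < R → ∃ C : ℝ, 0 < C ∧ ∃ ω : ℝ → ℝ,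
          MemLp ω (ENNReal.ofReal p) (muT T) ∧ (∀ᵐ t ∂(muT T), 0 ≤ ω t) ∧
          ∀ᵐ t ∂(muT T), ∀ (a : Vec d) (b : Vec m), ‖a‖ ≤ R →
            ‖f a b t‖ ≤ C * ‖b‖ ^ (q.toReal / p) + ω t) ∧
        (∀ R : ℝ, 0 < R → ∃ C : ℝ, 0 < C ∧ ∃ ω : ℝ → ℝ,
          MemLp ω (ENNReal.ofReal p) (muT T) ∧ (∀ᵐ t ∂(muT T), 0 ≤ ω t) ∧
          ∀ᵐ t ∂(muT T), ∀ (a : Vec d) (b : Vec m), ‖a‖ ≤ R →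
            ‖fx a b t‖ ≤ C * ‖b‖ ^ (q.toReal / p) + ω t)))
    -- assumption 3: a globally optimal solution exists
    (zopt : Traj d m) (hzopt : zopt ∈ OsetC T p q U x₀ f)
    (hzoptmin : ∀ w ∈ OsetC T p q U x₀ f, IvalC T θ ζ zopt ≤ IvalC T θ ζ w)
    -- assumption 4: boundedness of `S_{λ₀}(c) ∩ Ω_δ` and boundedness below of `Φ_{λ₀}`
    (c lam₀ δ : ℝ) (hc : IvalC T θ ζ zopt < c) (hlam₀ : 0 < lam₀) (hδ : 0 < δ)
    (hbdd : ∃ R : ℝ, ∀ z ∈ AsetC T p q U x₀,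
      PhiC T p θ f ζ lam₀ z < ((c : ℝ) : EReal) →
      penTerm T p f z.1 z.2.1 z.2.2 < ENNReal.ofReal δ →
      prodNorm T p q z.1 z.2.1 z.2.2 ≤ R)
    (hbelow : ∃ b : ℝ, ∀ z ∈ AsetC T p q U x₀, ((b : ℝ) : EReal) ≤ PhiC T p θ f ζ lam₀ z) :
    ∃ lamStar : ℝ, 0 ≤ lamStar ∧ ∀ lam : ℝ, lamStar ≤ lam →
      -- 1) the optimal values of the two problems coincide
      (⨅ z ∈ AsetC T p q U x₀, PhiC T p θ f ζ lam z) = ((IvalC T θ ζ zopt : ℝ) : EReal) ∧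
      -- 2) the globally optimal solutions coincide
      ({z ∈ AsetC T p q U x₀ | ∀ w ∈ AsetC T p q U x₀,
          PhiC T p θ f ζ lam z ≤ PhiC T p θ f ζ lam w}
        = {z ∈ OsetC T p q U x₀ f | ∀ w ∈ OsetC T p q U x₀ f,
            IvalC T θ ζ z ≤ IvalC T θ ζ w}) ∧
      -- 3) local minimisers in `S_λ(c)` coincide
      (∀ z ∈ AsetC T p q U x₀, PhiC T p θ f ζ lam z < ((c : ℝ) : EReal) →
        ((∃ ε : ℝ, 0 < ε ∧ ∀ w ∈ AsetC T p q U x₀, distC T p q w z < ε →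
            PhiC T p θ f ζ lam z ≤ PhiC T p θ f ζ lam w) ↔
          (z ∈ OsetC T p q U x₀ f ∧ ∃ ε : ℝ, 0 < ε ∧ ∀ w ∈ OsetC T p q U x₀ f,
            distC T p q w z < ε → IvalC T θ ζ z ≤ IvalC T θ ζ w))) ∧
      -- 4) inf-stationary points in `S_λ(c)` coincide
      (∀ z ∈ AsetC T p q U x₀, PhiC T p θ f ζ lam z < ((c : ℝ) : EReal) →
        ((0 : EReal) ≤ rateDescentWith (distC T p q) (PhiC T p θ f ζ lam)
            (AsetC T p q U x₀) z ↔
          (z ∈ OsetC T p q U x₀ f ∧ (0 : EReal) ≤ rateDescentWith (distC T p q)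
            (fun w => ((IvalC T θ ζ w : ℝ) : EReal)) (OsetC T p q U x₀ f) z))) := by
  have hp0 : 0 < p := by linarith
  have hp1 : (1 : ℝ≥0∞) ≤ ENNReal.ofReal p := by
    rw [← ENNReal.ofReal_one]
    exact ENNReal.ofReal_le_ofReal hp.le
  have hpne : ENNReal.ofReal p ≠ 0 := (zero_lt_one.trans_le hp1).ne'
  let Dx : Vec d → Vec m → ℝ → (Vec d →L[ℝ] ℝ) :=
    fun a b t => InnerProductSpace.toDual ℝ (Vec d) (θx a b t)
  let Du : Vec d → Vec m → ℝ → (Vec m →L[ℝ] ℝ) :=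
    fun a b t => InnerProductSpace.toDual ℝ (Vec m) (θu a b t)
  have hDx : ∀ a b t, ‖Dx a b t‖ = ‖θx a b t‖ := fun a b t => LinearIsometryEquiv.norm_map _ _
  have hDu : ∀ a b t, ‖Du a b t‖ = ‖θu a b t‖ := fun a b t => LinearIsometryEquiv.norm_map _ _
  obtain ⟨hMθ, hMx, hMu, hMf, hMfx⟩ : HasMajorants T q 1 θ ∧ HasMajorants T q 1 θx ∧
      HasMajorants T q q' θu ∧ HasMajorants T q (ENNReal.ofReal p) f ∧
      HasMajorants T q (ENNReal.ofReal p) fx := by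
    by_cases hqt : q = ⊤
    · subst hqt
      exact ⟨hasMajorants_top hθc, hasMajorants_top hθxc, hasMajorants_top hθuc,
        hasMajorants_top hfc, hasMajorants_top hfxc⟩
    · obtain ⟨g1, g2, g3, g4, g5⟩ := hgrowth.resolve_left hqt
      have hq0 : 0 < q.toReal := ENNReal.toReal_pos (zero_lt_one.trans_le hq).ne' hqt
      have hq'1 : 1 ≤ q' := by
        rw [← ENNReal.inv_le_one, ← hconj]
        exact le_add_self
      have hpq : ENNReal.ofReal p * ENNReal.ofReal (q.toReal / p) = q := by
        rw [← ENNReal.ofReal_mul hp0.le, mul_div_cancel₀ _ hp0.ne', ENNReal.ofReal_toReal hqt]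
      have h1q : (1 : ℝ≥0∞) * ENNReal.ofReal q.toReal = q := by
        rw [one_mul, ENNReal.ofReal_toReal hqt]
      refine ⟨hasMajorants_of_growth le_rfl (Or.inr ⟨hq0, h1q⟩) ?_,
        hasMajorants_of_growth le_rfl (Or.inr ⟨hq0, h1q⟩) ?_,
        hasMajorants_of_growth (l := q.toReal - 1) hq'1 ?_ g3,
        hasMajorants_of_growth hp1 (Or.inr ⟨by positivity, hpq⟩) g4,
        hasMajorants_of_growth hp1 (Or.inr ⟨by positivity, hpq⟩) g5⟩
      · simpa only [memLp_one_iff_integrable, Real.norm_eq_abs] using g1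
      · simpa only [memLp_one_iff_integrable] using g2
      · rcases hq.eq_or_lt with rfl | hlt
        · left
          simp
        · right
          refine ⟨?_, mul_ofReal_toReal_sub_one hlt hqt hconj⟩
          rw [sub_pos, ← ENNReal.toReal_one]
          exact (ENNReal.toReal_lt_toReal ENNReal.one_ne_top hqt).2 hlt
  have hobj := exists_objFun_lipschitz hT hq hconj (θx := Dx) (θu := Du) hζ hθc
    (fun b t ht a => (hθx b t ht a).hasFDerivAt) (fun a t ht b => (hθu a t ht b).hasFDerivAt)
    hMθ (hMx.of_norm_eq hDx) (hMu.of_norm_eq hDu)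
  obtain ⟨κ, hκ, hκint⟩ := exists_integral_norm_le (T := T) hp
  have hrmem : ∀ z ∈ AsetC T p q U x₀,
      MemLp (fun t => z.2.1 t - f (z.1 t) (z.2.2 t) t) (ENNReal.ofReal p) (muT T) := fun z hz =>
    hz.1.2.2.sub (hMf.memLp hT.le hfc (hz.1.continuousOn hT.le) hz.2.1)
  have hpenfin : ∀ z ∈ AsetC T p q U x₀, penTerm T p f z.1 z.2.1 z.2.2 ≠ ⊤ :=
    fun z hz => (hrmem z hz).2.ne
  have hPhi : ∀ lam : ℝ, ∀ z ∈ AsetC T p q U x₀, PhiC T p θ f ζ lam z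
      = ((IvalC T θ ζ z + lam * (penTerm T p f z.1 z.2.1 z.2.2).toReal : ℝ) : EReal) := by
    intro lam z hz
    unfold PhiC penFun IvalC
    rw [← EReal.coe_ennreal_toReal (hpenfin z hz)]
    push_cast
    rfl
  obtain ⟨R, hR⟩ := hbdd
  obtain ⟨b, hb⟩ := hbelow
  set R₁ : ℝ := ‖x₀‖ + κ * |R| + |R| with hR₁
  obtain ⟨K, hK, ρ, hρ, hcorr⟩ := exists_partial_correction hT hp hfc hfx hMf hMfx R₁
  obtain ⟨M, hM, hobjM⟩ := hobj (R₁ + 1)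
  have hTp : 0 ≤ T ^ p⁻¹ := by positivity
  refine completely_exact_of_descent (I := IvalC T θ ζ)
    (φ := fun z => (penTerm T p f z.1 z.2.1 z.2.2).toReal) (Φ := PhiC T p θ f ζ)
    (dd := distC T p q) (lam₀ := lam₀) (b := b) (c := c) (zopt := zopt)
    (K := T ^ p⁻¹ * K + K) (L := M * K) (ρ := min δ ρ)
    (fun z hz => hz.1) hPhi (fun _ => ENNReal.toReal_nonneg) ?_ ?_
    (fun x hx y hy z hz => distC_triangle hT.le hp hq hx hy hz)
    (fun z hz w hw h => congrArg ENNReal.toReal (penTerm_eq_of_distC_eq_zero hT.le hp hq hw hz h))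
    hzopt hzoptmin hc hlam₀ ?_ (by positivity) (by positivity) (lt_min hδ hρ) ?_ ?_
  · intro z hz
    simp only [ENNReal.toReal_eq_zero_iff, hpenfin z hz, or_false]
    unfold penTerm
    rw [eLpNorm_eq_zero_iff (hrmem z hz).1 hpne]
    constructor
    · intro h
      refine ⟨hz, ?_⟩
      filter_upwards [h] with t ht
      exact sub_eq_zero.1 ht
    · rintro ⟨-, h⟩
      filter_upwards [h] with t ht
      exact sub_eq_zero.2 ht
  · intro z w
    unfold distC
    positivity
  · intro z hz
    have h1 := hb z hz
    rwa [hPhi lam₀ z hz, EReal.coe_le_coe_iff] at h1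
  · intro z hz hzc hzφ s hs0 hs1
    have hzR := hR z hz (by rw [hPhi lam₀ z hz]; exact EReal.coe_lt_coe_iff.2 hzc) (by
      rw [← ENNReal.ofReal_toReal (hpenfin z hz)]
      exact (ENNReal.ofReal_lt_ofReal_iff hδ).2 (hzφ.trans_le (min_le_left _ _)))
    unfold prodNorm at hzR
    have n1 : 0 ≤ (eLpNorm z.1 (ENNReal.ofReal p) (muT T)).toReal := ENNReal.toReal_nonneg
    have n2 : 0 ≤ (eLpNorm z.2.1 (ENNReal.ofReal p) (muT T)).toReal := ENNReal.toReal_nonneg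
    have n3 : 0 ≤ (eLpNorm z.2.2 q (muT T)).toReal := ENNReal.toReal_nonneg
    have hRabs := le_abs_self R
    have hxR : ∀ t ∈ Icc 0 T, ‖z.1 t‖ ≤ R₁ := by
      intro t ht
      refine (norm_le_of_memA hp hκint hz t ht).trans ?_
      have : κ * (eLpNorm z.2.1 (ENNReal.ofReal p) (muT T)).toReal ≤ κ * |R| :=
        mul_le_mul_of_nonneg_left (by linarith) hκ.le
      linarith
    have huR : (eLpNorm z.2.2 q (muT T)).toReal ≤ R₁ := by
      have h1 : 0 ≤ κ * |R| := by positivity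
      have h2 := norm_nonneg x₀
      linarith
    obtain ⟨y, y', hyW, hy0, hyR, hypen, hyx, hyx'⟩ := hcorr z.1 z.2.1 z.2.2 hz.1 hz.2.1 hxR huR
      (hzφ.trans_le (min_le_right _ _)) s hs0 hs1
    set φ := (penTerm T p f z.1 z.2.1 z.2.2).toReal with hφ
    have hφ0 : 0 ≤ φ := ENNReal.toReal_nonneg
    have hu0 : eLpNorm (fun t => z.2.2 t - z.2.2 t) q (muT T) = 0 := by simp
    refine ⟨(y, y', z.2.2), ⟨hyW, hz.2.1, hz.2.2.1, hy0.trans hz.2.2.2⟩, hypen, ?_, ?_⟩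
    · have h1 : (eLpNorm (fun t => y t - z.1 t) (ENNReal.ofReal p) (muT T)).toReal
          ≤ T ^ p⁻¹ * (K * (s * φ)) := by
        have h2 : eLpNorm (fun t => y t - z.1 t) (ENNReal.ofReal p) (muT T)
            ≤ muT T univ ^ (ENNReal.ofReal p).toReal⁻¹ * ENNReal.ofReal (K * (s * φ)) := by
          refine eLpNorm_le_of_ae_bound ?_
          filter_upwards [ae_muT_mem T] with t ht
          exact hyx t (Ioc_subset_Icc_self ht)
        rw [muT_univ, ENNReal.toReal_ofReal hp0.le, ENNReal.ofReal_rpow_of_pos hT,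
          ← ENNReal.ofReal_mul hTp] at h2
        exact ENNReal.toReal_le_of_le_ofReal (by positivity) h2
      simp only [distC]
      rw [hu0, ENNReal.toReal_zero]
      linarith
    · have h1 := hobjM y z.1 z.2.2 z.2.2 (K * (s * φ)) (hyW.continuousOn hT.le)
        (hz.1.continuousOn hT.le) hz.2.1 hz.2.1 hyR (fun t ht => (hxR t ht).trans (by linarith))
        (by linarith) (by linarith) hyx
      rw [hu0, ENNReal.toReal_zero, add_zero] at h1
      have h2 := (abs_le.1 h1).2
      simp only [IvalC]
      linarith
  · intro z hz
    set S : ℝ := ‖x₀‖ + κ * ((eLpNorm z.2.1 (ENNReal.ofReal p) (muT T)).toReal + 1)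
      + (eLpNorm z.2.2 q (muT T)).toReal + 1 with hS
    obtain ⟨M', hM', hobjM'⟩ := hobj S
    refine ⟨M' * (κ + 1), by positivity, 1, one_pos, fun w hw hwd => ?_⟩
    have n0 : 0 ≤ (eLpNorm z.2.1 (ENNReal.ofReal p) (muT T)).toReal := ENNReal.toReal_nonneg
    have n0' : 0 ≤ (eLpNorm z.2.2 q (muT T)).toReal := ENNReal.toReal_nonneg
    have n1 : 0 ≤ (eLpNorm (fun t => w.1 t - z.1 t) (ENNReal.ofReal p) (muT T)).toReal :=
      ENNReal.toReal_nonneg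
    have n2 : 0 ≤ (eLpNorm (fun t => w.2.1 t - z.2.1 t) (ENNReal.ofReal p) (muT T)).toReal :=
      ENNReal.toReal_nonneg
    have n3 : 0 ≤ (eLpNorm (fun t => w.2.2 t - z.2.2 t) q (muT T)).toReal :=
      ENNReal.toReal_nonneg
    have hx₀ := norm_nonneg x₀
    have hsup := norm_sub_le_of_memA hp hκint hw hz
    have hzb := norm_le_of_memA hp hκint hz
    simp only [distC] at hwd
    have hκ1 : κ * (eLpNorm (fun t => w.2.1 t - z.2.1 t) (ENNReal.ofReal p) (muT T)).toReal ≤ κ :=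
      mul_le_of_le_one_right hκ.le (by linarith)
    have hκ2 : 0 ≤ κ * (eLpNorm z.2.1 (ENNReal.ofReal p) (muT T)).toReal := by positivity
    have hwu : (eLpNorm w.2.2 q (muT T)).toReal ≤ S := by
      have h1 : w.2.2 = (fun t => w.2.2 t - z.2.2 t) + z.2.2 := by
        ext1 t
        simp
      have hsubm : MemLp (fun t => w.2.2 t - z.2.2 t) q (muT T) := hw.2.1.sub hz.2.1
      have h2 : (eLpNorm w.2.2 q (muT T)).toReal
          ≤ (eLpNorm (fun t => w.2.2 t - z.2.2 t) q (muT T)).toReal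
            + (eLpNorm z.2.2 q (muT T)).toReal := by
        rw [← ENNReal.toReal_add hsubm.2.ne hz.2.1.2.ne]
        refine ENNReal.toReal_mono (ENNReal.add_ne_top.2 ⟨hsubm.2.ne, hz.2.1.2.ne⟩) ?_
        conv_lhs => rw [h1]
        exact eLpNorm_add_le hsubm.1 hz.2.1.1 hq
      linarith
    have hmain := hobjM' w.1 z.1 w.2.2 z.2.2 _ (hw.1.continuousOn hT.le) (hz.1.continuousOn hT.le)
      hw.2.1 hz.2.1
      (fun t ht => by
        have h1 : w.1 t = (w.1 t - z.1 t) + z.1 t := by abel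
        rw [h1]
        refine (norm_add_le _ _).trans ((add_le_add (hsup t ht) (hzb t ht)).trans ?_)
        linarith)
      (fun t ht => (hzb t ht).trans (by linarith)) hwu (by linarith) hsup
    refine hmain.trans ?_
    rw [mul_assoc]
    refine mul_le_mul_of_nonneg_left ?_ hM'
    simp only [distC]
    nlinarith [mul_nonneg hκ.le n1, mul_nonneg hκ.le n2, mul_nonneg hκ.le n3]
end
end

section
/- Let θ and f be continuous, the set U be bounded in L^∞_m(0,T), and suppose that for any R > 0 there exist C_R > 0 and an a.e. nonnegative function ω_R ∈ L^1(0,T) such that |f(x,u,t)| ≤ C_R|x| + ω_R(t) and θ(x,u,t) ≥ −C_R|x| − ω_R(t) for all (x,u) ∈ ℝ^d×ℝ^m with |u| ≤ R and a.e. t ∈ (0,T), and that there exist K₁, K₂ ≥ 0 such that ζ(x) ≥ −K₁|x| − K₂ for all x ∈ ℝ^d. Then there exists λ₀ ≥ 0 such that for any c ∈ ℝ, δ > 0 and λ ≥ λ₀ the set S_λ(c) ∩ Ω_δ is bounded in W^{1,p}_d(0,T) × L^q_m(0,T) and Φ_λ is bounded below on A; moreover, there exists a feasible point of the free-endpoint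 optimal control problem. -/
open MeasureTheory Set Filter Topology
open scoped ENNReal NNReal

noncomputable section

/-- Gronwall's inequality in integral form, with constant coefficients. -/
theorem le_mul_exp_of_le_add_integral {y : ℝ → ℝ} {K C T : ℝ} (hT : 0 ≤ T) (hC : 0 ≤ C)
    (hy : ContinuousOn y (Icc 0 T))
    (h : ∀ t ∈ Icc 0 T, y t ≤ K + C * ∫ s in (0 : ℝ)..t, y s) :
    ∀ t ∈ Icc 0 T, y t ≤ K * Real.exp (C * t) := by
  set z : ℝ → ℝ := IccExtend hT (domRestrict (Icc 0 T) y) with hz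
  have hzc : Continuous z := (continuousOn_iff_continuous_domRestrict.1 hy).Icc_extend'
  have hzy : ∀ t ∈ Icc 0 T, z t = y t := fun t ht => by
    rw [hz, IccExtend_of_mem _ _ ht]; rfl
  have hint : ∀ t ∈ Icc 0 T, ∫ s in (0 : ℝ)..t, y s = ∫ s in (0 : ℝ)..t, z s := fun t ht => by
    refine intervalIntegral.integral_congr fun s hs => ?_
    rw [uIcc_of_le ht.1] at hs
    exact (hzy s ⟨hs.1, hs.2.trans ht.2⟩).symm
  have hd : ∀ t, HasDerivAt (fun t => K + C * ∫ s in (0 : ℝ)..t, z s) (C * z t) t := fun t =>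
    ((hzc.integral_hasStrictDerivAt 0 t).hasDerivAt.const_mul C).const_add K
  have key := le_gronwallBound_of_liminf_deriv_right_le (δ := K) (K := C) (ε := 0)
    (f := fun t => K + C * ∫ s in (0 : ℝ)..t, z s) (f' := fun t => C * z t) (a := 0) (b := T)
    (fun t _ => (hd t).continuousAt.continuousWithinAt)
    (fun t _ r hr => (hd t).hasDerivWithinAt.liminf_right_slope_le hr) (by simp)
    (fun t ht => by
      have ht' := Ico_subset_Icc_self ht
      have := h t ht'
      rw [hint t ht', ← hzy t ht'] at this
      simpa using mul_le_mul_of_nonneg_left this hC)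
  intro t ht
  have h1 := key t ht
  rw [gronwallBound_ε0, sub_zero] at h1
  have h2 := h t ht
  rw [hint t ht] at h2
  exact h2.trans h1

/-- A trajectory that is the primitive of its integrable velocity is continuous. -/
theorem continuousOn_of_eq_add_integral {d : ℕ} {T : ℝ} (hT : 0 ≤ T) {x x' : ℝ → Vec d}
    (hx' : IntervalIntegrable x' volume 0 T)
    (hx : ∀ t ∈ Icc 0 T, x t = x 0 + ∫ s in (0 : ℝ)..t, x' s) : ContinuousOn x (Icc 0 T) := by
  have := intervalIntegral.continuousOn_primitive_interval' hx' left_mem_uIcc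
  rw [uIcc_of_le hT] at this
  exact (continuousOn_const.add this).congr hx

/-- A priori bound for trajectories whose velocity grows at most linearly. -/
theorem norm_le_of_integral_eq_of_linear_growth {d : ℕ} {T C : ℝ} (hT : 0 ≤ T) (hC : 0 ≤ C)
    {x x' : ℝ → Vec d} {η : ℝ → ℝ} (hx' : IntervalIntegrable x' volume 0 T)
    (hx : ∀ t ∈ Icc 0 T, x t = x 0 + ∫ s in (0 : ℝ)..t, x' s) (hη : Integrable η (muT T))
    (hη0 : ∀ᵐ t ∂muT T, 0 ≤ η t) (hb : ∀ᵐ t ∂muT T, ‖x' t‖ ≤ C * ‖x t‖ + η t) :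
    ∀ t ∈ Icc 0 T, ‖x t‖ ≤ (‖x 0‖ + ∫ s, η s ∂muT T) * Real.exp (C * T) := by
  intro t ht
  have hxc := continuousOn_of_eq_add_integral hT hx' hx
  have hηi : 0 ≤ ∫ s, η s ∂muT T := integral_nonneg_of_ae hη0
  refine (le_mul_exp_of_le_add_integral (y := fun t => ‖x t‖) (K := ‖x 0‖ + ∫ s, η s ∂muT T)
    hT hC hxc.norm (fun t ht => ?_) t ht).trans ?_
  · have hsub : Ioc 0 t ⊆ Ioc 0 T := Ioc_subset_Ioc_right ht.2
    have hle : volume.restrict (Ioc 0 t) ≤ muT T := Measure.restrict_mono hsub le_rfl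
    have hxi : IntervalIntegrable (fun s => ‖x s‖) volume 0 t :=
      (hxc.norm.mono (by rw [uIcc_of_le ht.1]; exact Icc_subset_Icc_right ht.2)).intervalIntegrable
    have hηt : IntervalIntegrable η volume 0 t :=
      (intervalIntegrable_iff_integrableOn_Ioc_of_le ht.1).2 (hη.mono_measure hle)
    have h1 : ‖∫ s in (0 : ℝ)..t, x' s‖ ≤ ∫ s in (0 : ℝ)..t, (C * ‖x s‖ + η s) := by
      refine intervalIntegral.norm_integral_le_of_norm_le ht.1 ?_
        ((hxi.const_mul C).add hηt)
      exact (ae_restrict_iff' measurableSet_Ioc).1 (ae_mono hle hb)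
    rw [intervalIntegral.integral_add (hxi.const_mul C) hηt,
      intervalIntegral.integral_const_mul] at h1
    have h2 : ∫ s in (0 : ℝ)..t, η s ≤ ∫ s, η s ∂muT T := by
      rw [intervalIntegral.integral_of_le ht.1]
      exact integral_mono_measure hle hη0 hη
    rw [hx t ht]
    linarith [norm_add_le (x 0) (∫ s in (0 : ℝ)..t, x' s)]
  · gcongr
    exact ht.2

/-- Superposition measurability for functions continuous in all variables. -/
theorem aestronglyMeasurable_comp_of_continuousOn {d m : ℕ} {T : ℝ}
    {f : Vec d → Vec m → ℝ → Vec d}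
    (hf : ContinuousOn (fun z : Vec d × Vec m × ℝ => f z.1 z.2.1 z.2.2)
      (univ ×ˢ univ ×ˢ Icc 0 T))
    {x : ℝ → Vec d} (hx : ContinuousOn x (Icc 0 T)) {u : ℝ → Vec m}
    (hu : AEStronglyMeasurable u (muT T)) :
    AEStronglyMeasurable (fun t => f (x t) (u t) t) (muT T) := by
  classical
  have hS : MeasurableSet ((univ : Set (Vec d)) ×ˢ (univ : Set (Vec m)) ×ˢ Icc (0 : ℝ) T) :=
    MeasurableSet.univ.prod (MeasurableSet.univ.prod measurableSet_Icc)
  have hF := hf.measurable_piecewise (g := fun _ => 0) continuousOn_const hS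
  have hxm : AEMeasurable x (muT T) :=
    (hx.mono Ioc_subset_Icc_self).aemeasurable measurableSet_Ioc
  have hc := hF.comp_aemeasurable (hxm.prodMk (hu.aemeasurable.prodMk aemeasurable_id))
  refine (hc.congr ?_).aestronglyMeasurable
  filter_upwards [ae_restrict_mem measurableSet_Ioc] with t ht
  simp [Set.piecewise, ht.1.le, ht.2]

/-- A function continuous in all variables is bounded on bounded sets. -/
theorem exists_bound_of_continuousOn {d m : ℕ} {T : ℝ} {f : Vec d → Vec m → ℝ → Vec d}
    (hf : ContinuousOn (fun z : Vec d × Vec m × ℝ => f z.1 z.2.1 z.2.2)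
      (univ ×ˢ univ ×ˢ Icc 0 T)) (M R : ℝ) :
    ∃ B : ℝ, 0 ≤ B ∧ ∀ a b t, ‖a‖ ≤ M → ‖b‖ ≤ R → t ∈ Icc 0 T → ‖f a b t‖ ≤ B := by
  obtain ⟨B, hB⟩ := ((isCompact_closedBall (0 : Vec d) M).prod
    ((isCompact_closedBall (0 : Vec m) R).prod (isCompact_Icc (a := 0) (b := T)))
    ).exists_bound_of_continuousOn (hf.mono (prod_mono (subset_univ _)
      (prod_mono (subset_univ _) subset_rfl)))
  refine ⟨max B 0, le_max_right _ _, fun a b t ha hb ht => le_max_of_le_left ?_⟩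
  exact hB (a, b, t) ⟨by simpa using ha, by simpa using hb, ht⟩

/-- Delayed Euler (Tonelli) approximations of the Carathéodory equation `x' = h(x,t)`. -/
theorem exists_delayed_solution {E : Type*} [NormedAddCommGroup E] [NormedSpace ℝ E]
    [MeasurableSpace E] [BorelSpace E] [SecondCountableTopology E]
    {h : E → ℝ → E} {B T ε : ℝ} (hε : 0 < ε) (x₀ : E)
    (hm : Measurable (Function.uncurry h)) (hB : ∀ a t, ‖h a t‖ ≤ B)
    (h0 : ∀ a t, t ≤ 0 → h a t = 0) :
    ∃ y : ℝ → E, (∀ s t, ‖y s - y t‖ ≤ B * |s - t|) ∧ y 0 = x₀ ∧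
      ∀ t ≤ T, y t = x₀ + ∫ s in (0 : ℝ)..t, h (y (s - ε)) s := by
  have hii : ∀ y : ℝ → E, Continuous y → ∀ a b,
      IntervalIntegrable (fun s => h (y (s - ε)) s) volume a b := fun y hy a b => by
    refine (intervalIntegrable_const (c := B)).mono_fun ?_ ?_
    · exact (hm.comp ((hy.comp (continuous_id.sub continuous_const)).measurable.prodMk
        measurable_id)).aestronglyMeasurable
    · exact Eventually.of_forall fun s => (hB _ _).trans (le_abs_self B)
  let Y : ℕ → ℝ → E := fun k => Nat.rec (fun _ => x₀)
    (fun _ y t => x₀ + ∫ s in (0 : ℝ)..t, h (y (s - ε)) s) k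
  have hYs : ∀ k t, Y (k + 1) t = x₀ + ∫ s in (0 : ℝ)..t, h (Y k (s - ε)) s := fun _ _ => rfl
  have hYc : ∀ k, Continuous (Y k) := fun k => by
    induction k with
    | zero => exact continuous_const
    | succ k ih => exact continuous_const.add (intervalIntegral.continuous_primitive (hii _ ih) 0)
  have hst : ∀ k : ℕ, ∀ t ≤ k * ε, Y (k + 1) t = Y k t := fun k => by
    induction k with
    | zero =>
      intro t ht
      rw [hYs, intervalIntegral.integral_congr_ae (g := fun _ => 0)]
      · simp [Y]
      · refine Eventually.of_forall fun s hs => h0 _ _ ?_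
        simp only [Nat.cast_zero, zero_mul] at ht
        rw [uIoc_of_ge ht] at hs
        exact hs.2
    | succ k ih =>
      intro t ht
      rw [hYs (k + 1), hYs k]
      congr 1
      refine intervalIntegral.integral_congr_ae (Eventually.of_forall fun s hs => ?_)
      have hs' : s ≤ (k + 1 : ℕ) * ε := (mem_uIoc.1 hs).elim (fun h => h.2.trans ht)
        (fun h => h.2.trans (by positivity))
      rw [ih (s - ε) (by push_cast at hs'; linarith)]
  obtain ⟨N, hN⟩ := exists_nat_ge (T / ε)
  rw [div_le_iff₀ hε] at hN
  refine ⟨Y (N + 1), fun s t => ?_, by simp [hYs], fun t ht => ?_⟩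
  · rw [hYs, hYs, add_sub_add_left_eq_sub,
      intervalIntegral.integral_interval_sub_left (hii _ (hYc N) _ _) (hii _ (hYc N) _ _)]
    exact intervalIntegral.norm_integral_le_of_norm_le_const fun _ _ => hB _ _
  · rw [← hst (N + 1) t (by push_cast; nlinarith), hYs (N + 1)]

/-- **Carathéodory's existence theorem** for bounded right-hand sides. -/
theorem exists_caratheodory_solution {d : ℕ} {h : Vec d → ℝ → Vec d} {B T : ℝ} (hT : 0 ≤ T)
    (x₀ : Vec d) (hm : Measurable (Function.uncurry h)) (hc : ∀ t, Continuous fun a => h a t)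
    (hB : ∀ a t, ‖h a t‖ ≤ B) (h0 : ∀ a t, t ≤ 0 → h a t = 0) :
    ∃ x : ℝ → Vec d, Continuous x ∧ x 0 = x₀ ∧
      ∀ t ∈ Icc 0 T, x t = x₀ + ∫ s in (0 : ℝ)..t, h (x s) s := by
  have hB0 : 0 ≤ B := (norm_nonneg _).trans (hB 0 0)
  have hε : ∀ n : ℕ, (0 : ℝ) < 1 / (n + 1) := fun n => Nat.one_div_pos_of_nat
  choose y hyL hy0 hy using fun n => exists_delayed_solution (T := T) (hε n) x₀ hm hB h0
  have hyc : ∀ n, Continuous (y n) := fun n =>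
    (LipschitzWith.of_dist_le_mul (K := B.toNNReal) fun s t => by
      rw [dist_eq_norm, Real.dist_eq, Real.coe_toNNReal _ hB0]; exact hyL n s t).continuous
  let I := Icc (0 : ℝ) T
  let Z : ℕ → BoundedContinuousFunction I (Vec d) := fun n =>
    BoundedContinuousFunction.mkOfCompact ⟨fun t => y n t, (hyc n).comp continuous_subtype_val⟩
  let A : Set (BoundedContinuousFunction I (Vec d)) :=
    {g | (∀ s t : I, dist (g s) (g t) ≤ B * dist s t) ∧ ∀ t, g t ∈ Metric.closedBall x₀ (B * T)}
  have hAc : IsClosed A := by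
    have hAeq : A = (⋂ s : I, ⋂ t : I, {g | dist (g s) (g t) ≤ B * dist s t}) ∩
        ⋂ t : I, {g | g t ∈ Metric.closedBall x₀ (B * T)} := by
      ext g
      simp [A]
    rw [hAeq]
    refine IsClosed.inter (isClosed_iInter fun s => isClosed_iInter fun t => isClosed_le
      ((continuous_eval_const s).dist (continuous_eval_const t)) continuous_const)
      (isClosed_iInter fun t => ?_)
    exact Metric.isClosed_closedBall.preimage (continuous_eval_const t)
  have hA : IsCompact A := by
    refine BoundedContinuousFunction.arzela_ascoli₂ _ (isCompact_closedBall x₀ (B * T)) A hAc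
      (fun g t hg => hg.2 t) ?_
    refine (LipschitzWith.uniformEquicontinuous _ B.toNNReal fun g =>
      LipschitzWith.of_dist_le_mul fun s t => ?_).equicontinuous
    rw [Real.coe_toNNReal _ hB0]
    exact g.2.1 s t
  have hZA : ∀ n, Z n ∈ A := fun n => by
    refine ⟨fun s t => ?_, fun t => ?_⟩
    · rw [dist_eq_norm, Subtype.dist_eq, Real.dist_eq]
      exact hyL n s t
    · rw [Metric.mem_closedBall, dist_eq_norm]
      have := hyL n t 0
      rw [hy0, sub_zero, abs_of_nonneg t.2.1] at this
      exact this.trans (mul_le_mul_of_nonneg_left t.2.2 hB0)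
  obtain ⟨g, -, φ, hφ, hg⟩ := hA.tendsto_subseq hZA
  have hlim : ∀ t (ht : t ∈ Icc 0 T), Tendsto (fun n => y (φ n) t) atTop (𝓝 (g ⟨t, ht⟩)) :=
    fun t ht => ((continuous_eval_const (F := BoundedContinuousFunction I (Vec d)) (⟨t, ht⟩ : I)).tendsto g
      ).comp hg
  have hxt : ∀ t (ht : t ∈ Icc 0 T), IccExtend hT g t = g ⟨t, ht⟩ := fun t ht =>
    IccExtend_of_mem _ _ ht
  have hx0 : IccExtend hT g 0 = x₀ := by
    rw [hxt 0 ⟨le_rfl, hT⟩]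
    exact tendsto_nhds_unique (hlim 0 ⟨le_rfl, hT⟩) (by simp [hy0])
  refine ⟨IccExtend hT g, g.continuous.Icc_extend', hx0, fun t ht => ?_⟩
  rw [hxt t ht]
  refine tendsto_nhds_unique (hlim t ht) ?_
  have hrw : ∀ n, y (φ n) t = x₀ + ∫ s in (0 : ℝ)..t, h (y (φ n) (s - 1 / ((φ n : ℕ) + 1))) s :=
    fun n => hy (φ n) t ht.2
  simp only [hrw]
  refine tendsto_const_nhds.add ?_
  refine intervalIntegral.tendsto_integral_filter_of_dominated_convergence (fun _ => B)
    (Eventually.of_forall fun n => ?_) (Eventually.of_forall fun n => Eventually.of_forall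
      fun s _ => hB _ _) intervalIntegrable_const (Eventually.of_forall fun s hs => ?_)
  · exact (hm.comp (((hyc (φ n)).comp (continuous_id.sub continuous_const)).measurable.prodMk
      measurable_id)).aestronglyMeasurable
  · rw [uIoc_of_le ht.1] at hs
    have hsT : s ∈ Icc 0 T := ⟨hs.1.le, hs.2.trans ht.2⟩
    refine ((hc s).tendsto _).comp ?_
    rw [hxt s hsT]
    refine (hlim s hsT).congr_dist ?_
    have hz : Tendsto (fun n : ℕ => B * (1 / ((φ n : ℕ) + 1 : ℝ))) atTop (𝓝 0) := by
      simpa using (tendsto_one_div_add_atTop_nhds_zero_nat.comp hφ.tendsto_atTop).const_mul B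
    refine squeeze_zero (fun _ => dist_nonneg) (fun n => ?_) hz
    rw [dist_eq_norm]
    refine (hyL (φ n) _ _).trans ?_
    rw [sub_sub_cancel, abs_of_pos (hε _)]

/-- A control bounded by `R` admits a trajectory starting at `x₀` whenever `f` is continuous and
grows at most linearly in the state along such controls. -/
theorem exists_trajectory {d m : ℕ} {T C R : ℝ} (hT : 0 < T) (x₀ : Vec d) (hC : 0 ≤ C)
    (hR : 0 ≤ R) {f : Vec d → Vec m → ℝ → Vec d}
    (hf : ContinuousOn (fun z : Vec d × Vec m × ℝ => f z.1 z.2.1 z.2.2)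
      (univ ×ˢ univ ×ˢ Icc 0 T))
    {ω : ℝ → ℝ} (hω : Integrable ω (muT T)) (hω0 : ∀ᵐ t ∂muT T, 0 ≤ ω t)
    (hg : ∀ᵐ t ∂muT T, ∀ (a : Vec d) (b : Vec m), ‖b‖ ≤ R → ‖f a b t‖ ≤ C * ‖a‖ + ω t)
    {u : ℝ → Vec m} (hu : AEStronglyMeasurable u (muT T)) (huR : ∀ᵐ t ∂muT T, ‖u t‖ ≤ R)
    (p : ℝ) :
    ∃ x x' : ℝ → Vec d, InW T p x x' ∧ x 0 = x₀ ∧ ∀ᵐ t ∂muT T, x' t = f (x t) (u t) t := by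
  classical
  obtain ⟨v, hvm, hvR, hvu⟩ : ∃ v : ℝ → Vec m, Measurable v ∧ (∀ t, ‖v t‖ ≤ R) ∧
      ∀ᵐ t ∂muT T, v t = u t := by
    have hw := hu.stronglyMeasurable_mk.measurable
    refine ⟨fun t => if ‖hu.mk u t‖ ≤ R then hu.mk u t else 0,
      Measurable.ite (measurableSet_le hw.norm measurable_const) hw measurable_const,
      fun t => ?_, ?_⟩
    · dsimp only
      split_ifs with h
      · exact h
      · simpa using hR
    · filter_upwards [hu.ae_eq_mk, huR] with t h1 h2
      rw [← h1, if_pos h2]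
  set M : ℝ := (‖x₀‖ + ∫ s, ω s ∂muT T) * Real.exp (C * T) + 1 with hM
  have hM0 : 0 < M := by
    have : 0 ≤ ∫ s, ω s ∂muT T := integral_nonneg_of_ae hω0
    positivity
  let P : Vec d → Vec d := fun a => (M / max M ‖a‖) • a
  have hmax : ∀ a : Vec d, 0 < max M ‖a‖ := fun a => lt_max_of_lt_left hM0
  have hPc : Continuous P :=
    (continuous_const.div (continuous_const.max continuous_norm) fun a => (hmax a).ne').smul
      continuous_id
  have hPn : ∀ a, ‖P a‖ = M / max M ‖a‖ * ‖a‖ := fun a => by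
    rw [norm_smul, Real.norm_of_nonneg (div_pos hM0 (hmax a)).le]
  have hPM : ∀ a, ‖P a‖ ≤ M := fun a => by
    rw [hPn, div_mul_eq_mul_div, div_le_iff₀ (hmax a)]
    exact mul_le_mul_of_nonneg_left (le_max_right _ _) hM0.le
  have hPle : ∀ a, ‖P a‖ ≤ ‖a‖ := fun a => by
    rw [hPn]
    exact mul_le_of_le_one_left (norm_nonneg a) ((div_le_one (hmax a)).2 (le_max_left _ _))
  have hPid : ∀ a, ‖a‖ ≤ M → P a = a := fun a ha => by
    simp only [P]
    rw [max_eq_left ha, div_self hM0.ne', one_smul]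
  obtain ⟨B, hB0, hB⟩ := exists_bound_of_continuousOn hf M R
  let h : Vec d → ℝ → Vec d := fun a t => if t ∈ Ioc 0 T then f (P a) (v t) t else 0
  have hhB : ∀ a t, ‖h a t‖ ≤ B := fun a t => by
    simp only [h]
    split_ifs with ht
    · exact hB _ _ _ (hPM a) (hvR t) (Ioc_subset_Icc_self ht)
    · simpa using hB0
  have hhm : Measurable (Function.uncurry h) := by
    have hS : MeasurableSet ((univ : Set (Vec d)) ×ˢ (univ : Set (Vec m)) ×ˢ Ioc (0 : ℝ) T) :=
      MeasurableSet.univ.prod (MeasurableSet.univ.prod measurableSet_Ioc)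
    have hF := (hf.mono (prod_mono subset_rfl (prod_mono subset_rfl
      Ioc_subset_Icc_self))).measurable_piecewise (g := fun _ => 0) continuousOn_const hS
    convert! hF.comp ((hPc.measurable.comp measurable_fst).prodMk
      ((hvm.comp measurable_snd).prodMk measurable_snd)) using 1
    ext1 ⟨a, t⟩
    simp [Set.piecewise, h, Function.uncurry]
  have hhc : ∀ t, Continuous fun a => h a t := fun t => by
    by_cases ht : t ∈ Ioc 0 T
    · simp only [h, if_pos ht]
      exact hf.comp_continuous (hPc.prodMk (continuous_const.prodMk continuous_const))
        fun a => ⟨mem_univ _, mem_univ _, Ioc_subset_Icc_self ht⟩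
    · simp only [h, if_neg ht]
      exact continuous_const
  obtain ⟨x, hxc, hx0, hx⟩ := exists_caratheodory_solution hT.le x₀ hhm hhc hhB
    fun a t ht => if_neg fun h' => ht.not_gt h'.1
  have hxm : AEStronglyMeasurable (fun t => h (x t) t) volume :=
    (hhm.comp (hxc.measurable.prodMk measurable_id)).aestronglyMeasurable
  have hxi : IntervalIntegrable (fun t => h (x t) t) volume 0 T :=
    (intervalIntegrable_const (c := B)).mono_fun hxm.restrict
      (Eventually.of_forall fun t => (hhB _ _).trans (le_abs_self B))
  have hx' : ∀ t ∈ Icc 0 T, x t = x 0 + ∫ s in (0 : ℝ)..t, h (x s) s := by rwa [hx0]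
  have hbd := (norm_le_of_integral_eq_of_linear_growth hT.le hC hxi hx' hω hω0 (by
    filter_upwards [hg, ae_restrict_mem measurableSet_Ioc] with t h1 h2
    simp only [h, if_pos h2]
    exact (h1 _ _ (hvR t)).trans (by gcongr; exact hPle _)))
  refine ⟨x, fun t => h (x t) t, ⟨hxi, hx', ?_⟩, hx0, ?_⟩
  · exact MemLp.of_bound hxm.restrict B (Eventually.of_forall fun t => hhB _ _)
  · filter_upwards [hvu, ae_restrict_mem measurableSet_Ioc] with t h1 h2
    have hxM : ‖x t‖ ≤ M := by
      have := hbd t (Ioc_subset_Icc_self h2)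
      rw [hx0] at this
      linarith
    simp only [h, if_pos h2, hPid _ hxM, h1]

/-- The state is controlled by the value of the penalty term. -/
theorem norm_le_of_penTerm_lt_top {d m : ℕ} {T C R p : ℝ} (hT : 0 < T) (hp : 1 < p) (hC : 0 ≤ C)
    {f : Vec d → Vec m → ℝ → Vec d}
    (hf : ContinuousOn (fun z : Vec d × Vec m × ℝ => f z.1 z.2.1 z.2.2)
      (univ ×ˢ univ ×ˢ Icc 0 T))
    {ω : ℝ → ℝ} (hω : Integrable ω (muT T)) (hω0 : ∀ᵐ t ∂muT T, 0 ≤ ω t)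
    (hg : ∀ᵐ t ∂muT T, ∀ (a : Vec d) (b : Vec m), ‖b‖ ≤ R → ‖f a b t‖ ≤ C * ‖a‖ + ω t)
    {x x' : ℝ → Vec d} {u : ℝ → Vec m} (hW : InW T p x x')
    (hu : AEStronglyMeasurable u (muT T)) (huR : ∀ᵐ t ∂muT T, ‖u t‖ ≤ R)
    (hφ : penTerm T p f x x' u < ⊤) :
    ContinuousOn x (Icc 0 T) ∧ ∀ t ∈ Icc 0 T, ‖x t‖ ≤
      (‖x 0‖ + ∫ s, ω s ∂muT T + (penTerm T p f x x' u).toReal *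
        (muT T univ ^ (1 - 1 / p)).toReal) * Real.exp (C * T) := by
  have hxc := continuousOn_of_eq_add_integral hT.le hW.1 hW.2.1
  have hm : AEStronglyMeasurable (fun t => x' t - f (x t) (u t) t) (muT T) :=
    hW.2.2.1.sub (aestronglyMeasurable_comp_of_continuousOn hf hxc hu)
  have hp1 : (1 : ℝ≥0∞) ≤ ENNReal.ofReal p := by
    rw [← ENNReal.ofReal_one]
    exact ENNReal.ofReal_le_ofReal hp.le
  have hi : Integrable (fun t => x' t - f (x t) (u t) t) (muT T) :=
    MemLp.integrable hp1 ⟨hm, hφ⟩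
  have hle : ∫ t, ‖x' t - f (x t) (u t) t‖ ∂muT T ≤
      (penTerm T p f x x' u).toReal * (muT T univ ^ (1 - 1 / p)).toReal := by
    have h1 := eLpNorm_le_eLpNorm_mul_rpow_measure_univ hp1 hm
    rw [ENNReal.toReal_ofReal (by linarith), ENNReal.toReal_one, div_one] at h1
    rw [integral_norm_eq_lintegral_enorm hm, ← eLpNorm_one_eq_lintegral_enorm,
      ← ENNReal.toReal_mul]
    refine ENNReal.toReal_mono (ENNReal.mul_ne_top hφ.ne ?_) h1
    refine ENNReal.rpow_ne_top_of_nonneg ?_ (measure_ne_top _ _)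
    rw [sub_nonneg, div_le_one (by linarith)]
    exact hp.le
  refine ⟨hxc, fun t ht => ?_⟩
  refine ((norm_le_of_integral_eq_of_linear_growth hT.le hC hW.1 hW.2.1
    (η := fun t => ω t + ‖x' t - f (x t) (u t) t‖) (hω.add hi.norm) ?_ ?_) t ht).trans ?_
  · filter_upwards [hω0] with t h
    positivity
  · filter_upwards [hg, huR] with t h1 h2
    have := norm_add_le (x' t - f (x t) (u t) t) (f (x t) (u t) t)
    rw [sub_add_cancel] at this
    linarith [h1 (x t) (u t) h2]
  · rw [integral_add hω hi.norm, ← add_assoc]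
    gcongr

/-- Lower bound for the objective functional along bounded trajectories. -/
theorem le_objFun {d m : ℕ} {T C R K₁ K₂ N : ℝ} (hT : 0 ≤ T) (hC : 0 ≤ C) (hK₁ : 0 ≤ K₁)
    {θ : Vec d → Vec m → ℝ → ℝ} {ζ : Vec d → ℝ}
    {ω : ℝ → ℝ} (hω : Integrable ω (muT T)) (hω0 : ∀ᵐ t ∂muT T, 0 ≤ ω t)
    (hg : ∀ᵐ t ∂muT T, ∀ (a : Vec d) (b : Vec m), ‖b‖ ≤ R → -(C * ‖a‖) - ω t ≤ θ a b t)
    (hζ : ∀ a : Vec d, -(K₁ * ‖a‖) - K₂ ≤ ζ a)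
    {x : ℝ → Vec d} {u : ℝ → Vec m} (huR : ∀ᵐ t ∂muT T, ‖u t‖ ≤ R)
    (hx : ∀ t ∈ Icc 0 T, ‖x t‖ ≤ N) :
    -((C * T + K₁) * N) - ∫ s, ω s ∂muT T - K₂ ≤ objFun T θ ζ x u := by
  have hN : 0 ≤ N := (norm_nonneg _).trans (hx 0 ⟨le_rfl, hT⟩)
  have hωi : 0 ≤ ∫ s, ω s ∂muT T := integral_nonneg_of_ae hω0
  have h1 : -(C * T * N) - ∫ s, ω s ∂muT T ≤ ∫ t in Ioc (0 : ℝ) T, θ (x t) (u t) t := by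
    change _ ≤ ∫ t, θ (x t) (u t) t ∂muT T
    by_cases hi : Integrable (fun t => θ (x t) (u t) t) (muT T)
    · have h2 : ∫ t, (-(C * N) - ω t) ∂muT T ≤ ∫ t, θ (x t) (u t) t ∂muT T := by
        refine integral_mono_ae ((integrable_const _).sub hω) hi ?_
        filter_upwards [hg, huR, ae_restrict_mem measurableSet_Ioc] with t h1 h2 h3
        refine le_trans ?_ (h1 _ _ h2)
        have := mul_le_mul_of_nonneg_left (hx t (Ioc_subset_Icc_self h3)) hC
        linarith
      rw [integral_sub (integrable_const _) hω, integral_const] at h2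
      have h3 : (muT T).real univ = T := by simp [muT, measureReal_def, hT]
      rw [h3, smul_eq_mul] at h2
      linarith
    · rw [integral_undef hi]
      have : 0 ≤ C * T * N := by positivity
      linarith
  have h2 := mul_le_mul_of_nonneg_left (hx T ⟨hT, le_rfl⟩) hK₁
  have h3 := hζ (x T)
  unfold objFun
  linarith

/-- Proposition 3.1, part 1: if the controls are uniformly bounded in `L^∞`, `f` has linear growth
in `x`, `θ` and `ζ` have linear lower bounds, then there exists `λ₀ ≥ 0` such that for all
`c ∈ ℝ`, `δ > 0` and `λ ≥ λ₀` the set `S_λ(c) ∩ Ω_δ` is bounded in `W^{1,p}_d × L^q_m` and `Φ_λ`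
is bounded below on `A`; moreover a feasible point of the free-endpoint problem exists. -/
theorem boundedness_for_bounded_controls {d m : ℕ} (T : ℝ) (hT : 0 < T) (x₀ : Vec d)
    (p : ℝ) (hp : 1 < p) (q : ℝ≥0∞) (hq : 1 ≤ q)
    (θ : Vec d → Vec m → ℝ → ℝ) (f : Vec d → Vec m → ℝ → Vec d) (ζ : Vec d → ℝ)
    (U : Set (ℝ → Vec m)) (hUne : U.Nonempty) (hUsub : ∀ u ∈ U, MemLp u q (muT T))
    (hθc : ContinuousOn (fun z : Vec d × Vec m × ℝ => θ z.1 z.2.1 z.2.2)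
      (Set.univ ×ˢ Set.univ ×ˢ Set.Icc 0 T))
    (hfc : ContinuousOn (fun z : Vec d × Vec m × ℝ => f z.1 z.2.1 z.2.2)
      (Set.univ ×ˢ Set.univ ×ˢ Set.Icc 0 T))
    -- `U` is bounded in `L^∞_m(0,T)`
    (hUbdd : ∃ R : ℝ, ∀ u ∈ U, eLpNorm u ⊤ (muT T) ≤ ENNReal.ofReal R)
    -- growth conditions on `f` and `θ` for bounded controls
    (hgrowth : ∀ R : ℝ, 0 < R → ∃ C : ℝ, 0 < C ∧ ∃ ω : ℝ → ℝ,
      Integrable ω (muT T) ∧ (∀ᵐ t ∂(muT T), 0 ≤ ω t) ∧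
      ∀ᵐ t ∂(muT T), ∀ (a : Vec d) (b : Vec m), ‖b‖ ≤ R →
        ‖f a b t‖ ≤ C * ‖a‖ + ω t ∧ -(C * ‖a‖) - ω t ≤ θ a b t)
    -- linear lower bound on `ζ`
    (hζ : ∃ K₁ K₂ : ℝ, 0 ≤ K₁ ∧ 0 ≤ K₂ ∧ ∀ a : Vec d, -(K₁ * ‖a‖) - K₂ ≤ ζ a) :
    (∃ lam₀ : ℝ, 0 ≤ lam₀ ∧ ∀ c δ lam : ℝ, 0 < δ → lam₀ ≤ lam →
      (∃ R : ℝ, ∀ (x x' : ℝ → Vec d) (u : ℝ → Vec m), memA T p q U x₀ x x' u →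
        penFun T p θ f ζ lam x x' u < ((c : ℝ) : EReal) →
        penTerm T p f x x' u < ENNReal.ofReal δ →
        prodNorm T p q x x' u ≤ R) ∧
      (∃ b : ℝ, ∀ (x x' : ℝ → Vec d) (u : ℝ → Vec m), memA T p q U x₀ x x' u →
        ((b : ℝ) : EReal) ≤ penFun T p θ f ζ lam x x' u)) ∧
    (∃ (x x' : ℝ → Vec d) (u : ℝ → Vec m), memA T p q U x₀ x x' u ∧
      ∀ᵐ t ∂(muT T), x' t = f (x t) (u t) t) := by
  obtain ⟨R₀, hR₀⟩ := hUbdd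
  set R : ℝ := max R₀ 1
  have hR : 0 < R := lt_max_of_lt_right one_pos
  have huR : ∀ u ∈ U, ∀ᵐ t ∂muT T, ‖u t‖ ≤ R := fun u hu => by
    have h1 := (hR₀ u hu).trans (ENNReal.ofReal_le_ofReal (le_max_left R₀ 1))
    rw [eLpNorm_exponent_top] at h1
    filter_upwards [ae_le_eLpNormEssSup (f := u) (μ := muT T)] with t ht
    have h2 := ht.trans h1
    rwa [← ofReal_norm, ENNReal.ofReal_le_ofReal_iff hR.le] at h2
  obtain ⟨C, hC, ω, hω, hω0, hg⟩ := hgrowth R hR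
  obtain ⟨K₁, K₂, hK₁, hK₂, hζ⟩ := hζ
  have hgf : ∀ᵐ t ∂muT T, ∀ (a : Vec d) (b : Vec m), ‖b‖ ≤ R → ‖f a b t‖ ≤ C * ‖a‖ + ω t :=
    hg.mono fun t h a b hb => (h a b hb).1
  have hgθ : ∀ᵐ t ∂muT T, ∀ (a : Vec d) (b : Vec m), ‖b‖ ≤ R → -(C * ‖a‖) - ω t ≤ θ a b t :=
    hg.mono fun t h a b hb => (h a b hb).2
  set κ : ℝ := (muT T univ ^ (1 - 1 / p)).toReal
  have hκ : 0 ≤ κ := ENNReal.toReal_nonneg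
  set W : ℝ := ∫ s, ω s ∂muT T
  set E : ℝ := Real.exp (C * T)
  have hx_bound : ∀ (x x' : ℝ → Vec d) (u : ℝ → Vec m), memA T p q U x₀ x x' u →
      penTerm T p f x x' u < ⊤ → ContinuousOn x (Icc 0 T) ∧ ∀ t ∈ Icc 0 T,
        ‖x t‖ ≤ (‖x₀‖ + W + (penTerm T p f x x' u).toReal * κ) * E := fun x x' u hA hφ => by
    have := norm_le_of_penTerm_lt_top hT hp hC.le hfc hω hω0 hgf hA.1 hA.2.1.1
      (huR u hA.2.2.1) hφ
    rwa [hA.2.2.2] at this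
  refine ⟨⟨max 1 ((C * T + K₁) * (κ * E)), by positivity, fun c δ lam hδ hlam => ⟨?_, ?_⟩⟩, ?_⟩
  · set N : ℝ := (‖x₀‖ + W + δ * κ) * E
    obtain ⟨B, hB0, hB⟩ := exists_bound_of_continuousOn hfc N R
    have hfin : ∀ (r : ℝ≥0∞) (a : ℝ), muT T univ ^ r.toReal⁻¹ * ENNReal.ofReal a ≠ ⊤ :=
      fun r a => ENNReal.mul_ne_top (ENNReal.rpow_ne_top_of_nonneg
        (inv_nonneg.2 ENNReal.toReal_nonneg) (measure_ne_top _ _)) ENNReal.ofReal_ne_top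
    set P : ℝ≥0∞ := ENNReal.ofReal p
    have hP1 : 1 ≤ P := by
      rw [← ENNReal.ofReal_one]
      exact ENNReal.ofReal_le_ofReal hp.le
    refine ⟨(muT T univ ^ P.toReal⁻¹ * ENNReal.ofReal N).toReal +
      (ENNReal.ofReal δ + muT T univ ^ P.toReal⁻¹ * ENNReal.ofReal B).toReal +
      (muT T univ ^ q.toReal⁻¹ * ENNReal.ofReal R).toReal, fun x x' u hA _ hφ => ?_⟩
    obtain ⟨hxc, hxb⟩ := hx_bound x x' u hA (hφ.trans ENNReal.ofReal_lt_top)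
    have hxN : ∀ t ∈ Icc 0 T, ‖x t‖ ≤ N := fun t ht => by
      refine (hxb t ht).trans ?_
      have : (penTerm T p f x x' u).toReal ≤ δ :=
        ENNReal.toReal_le_of_le_ofReal hδ.le hφ.le
      simp only [N]
      gcongr
    have hfm := aestronglyMeasurable_comp_of_continuousOn hfc hxc hA.2.1.1
    have hu := huR u hA.2.2.1
    unfold prodNorm
    refine add_le_add (add_le_add ?_ ?_) ?_
    · refine ENNReal.toReal_mono (hfin _ _) (eLpNorm_le_of_ae_bound ?_)
      filter_upwards [ae_restrict_mem measurableSet_Ioc] with t ht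
      exact hxN t (Ioc_subset_Icc_self ht)
    · refine ENNReal.toReal_mono (ENNReal.add_ne_top.2 ⟨ENNReal.ofReal_ne_top, hfin _ _⟩) ?_
      have h1 := eLpNorm_add_le (hA.1.2.2.1.sub hfm) hfm hP1
      rw [sub_add_cancel] at h1
      refine h1.trans (add_le_add hφ.le (eLpNorm_le_of_ae_bound ?_))
      filter_upwards [ae_restrict_mem measurableSet_Ioc, hu] with t ht hut
      exact hB _ _ _ (hxN t (Ioc_subset_Icc_self ht)) hut (Ioc_subset_Icc_self ht)
    · exact ENNReal.toReal_mono (hfin _ _) (eLpNorm_le_of_ae_bound hu)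
  · refine ⟨-((C * T + K₁) * ((‖x₀‖ + W) * E)) - W - K₂, fun x x' u hA => ?_⟩
    have hlam0 : 0 < lam := one_pos.trans_le ((le_max_left _ _).trans hlam)
    unfold penFun
    rcases eq_top_or_lt_top (penTerm T p f x x' u) with hφ | hφ
    · rw [hφ, EReal.coe_ennreal_top, EReal.coe_mul_top_of_pos hlam0, EReal.coe_add_top]
      exact le_top
    · have h1 := le_objFun hT.le hC.le hK₁ hω hω0 hgθ hζ (huR u hA.2.2.1)
        (hx_bound x x' u hA hφ).2
      have h2 := mul_le_mul_of_nonneg_right ((le_max_right _ _).trans hlam)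
        (ENNReal.toReal_nonneg (a := penTerm T p f x x' u))
      rw [← EReal.coe_ennreal_toReal hφ.ne]
      norm_cast
      linarith
  · obtain ⟨u, hu⟩ := hUne
    obtain ⟨x, x', hW, hx0, hx'⟩ := exists_trajectory hT x₀ hC.le hR.le hfc hω hω0 hgf
      (hUsub u hu).1 (huR u hu) p
    exact ⟨x, x', u, ⟨hW, hUsub u hu, hu, hx0⟩, hx'⟩
end
end
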